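/- Let d ≥ 1 and assume that DHL(d) holds. Let T⃗ = (T_1,…,T_d) be a vector homogeneous tree, W a homogeneous tree, 0 < ε ≤ 1 and D : ⊗T⃗ → 2^W an ε-dense level selection. Then for every 0 < δ < ε there exist a vector strong subtree R⃗ of T⃗ with root tuple r⃗_0 and a constant 0 < θ ≤ 1 such that, setting G = {w ∈ D(r⃗_0) : the pair (R⃗, w) is strongly θ-correlated with respect to D}, we have dens(G) ≥ dens(D(r⃗_0)) − δ. -/

import Mathlib

open Filter

namespace DHLPaper

/-- The tree `b^{<ℕ}` of all finite sequences with values in `{0,…,b−1}`,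
partially ordered by end-extension (`List.IsPrefix`, written `<+:`). -/
def bSeq (b : ℕ) : Set (List ℕ) := {t | ∀ x ∈ t, x < b}

/-- The set of successors of `t` in `T`: `Suc_T(t) = {s ∈ T : t ≤ s}`. -/
def suc (T : Set (List ℕ)) (t : List ℕ) : Set (List ℕ) := {s ∈ T | t <+: s}

/-- `s` is an immediate successor of `t` in `T`. -/
def ImmSuc (T : Set (List ℕ)) (t s : List ℕ) : Prop :=
  t ∈ T ∧ s ∈ T ∧ t <+: s ∧ t ≠ s ∧ ∀ u ∈ T, t <+: u → u <+: s → u = t ∨ u = s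

/-- The `n`-th level of `T`: the nodes of `T` with exactly `n` strict predecessors in `T`. -/
def level (T : Set (List ℕ)) (n : ℕ) : Set (List ℕ) :=
  {t ∈ T | {s ∈ T | s <+: t ∧ s ≠ t}.ncard = n}

/-- `T` has exactly one minimal node. -/
def UniquelyRooted (T : Set (List ℕ)) : Prop := ∃! r, r ∈ level T 0

/-- Every node of `T` has finitely many immediate successors in `T`. -/
def FinitelyBranching (T : Set (List ℕ)) : Prop := ∀ t ∈ T, {s | ImmSuc T t s}.Finite

/-- Every node of `T` has at least one immediate successor in `T`. -/
def Pruned (T : Set (List ℕ)) : Prop := ∀ t ∈ T, ∃ s, ImmSuc T t s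

/-- `S` is a strong subtree of `T` whose level set `L_T(S)` is enumerated by the strictly
increasing map `l`: `S(n) ⊆ T(l n)` for every `n`, `S` is uniquely rooted, and for every
`s ∈ S` and every immediate successor `t` of `s` in `T` there is a unique immediate
successor `s'` of `s` in `S` with `t ≤ s'`. -/
def IsStrongSubtreeWith (T S : Set (List ℕ)) (l : ℕ → ℕ) : Prop :=
  S ⊆ T ∧ UniquelyRooted S ∧ StrictMono l ∧
    (∀ n, level S n ⊆ level T (l n)) ∧
    (∀ s ∈ S, ∀ t, ImmSuc T s t → ∃! s', ImmSuc S s s' ∧ t <+: s')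

/-- `S` is a strong subtree of `T`. -/
def IsStrongSubtree (T S : Set (List ℕ)) : Prop := ∃ l, IsStrongSubtreeWith T S l

/-- A homogeneous tree with branching number `b`: a strong subtree of `b^{<ℕ}`, `b ≥ 2`. -/
def IsHomogeneous (b : ℕ) (T : Set (List ℕ)) : Prop := 2 ≤ b ∧ IsStrongSubtree (bSeq b) T

/-- A vector homogeneous tree: a `d`-tuple of homogeneous trees. -/
def IsVecHomogeneous {d : ℕ} (b : Fin d → ℕ) (T : Fin d → Set (List ℕ)) : Prop :=
  ∀ i, IsHomogeneous (b i) (T i)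

/-- Vector strong subtree: componentwise strong subtrees with a common level set. -/
def IsVecStrongSubtree {d : ℕ} (T S : Fin d → Set (List ℕ)) : Prop :=
  ∃ l, ∀ i, IsStrongSubtreeWith (T i) (S i) l

/-- `⊗T(n) = T_1(n) × ⋯ × T_d(n)`. -/
def vecLevel {d : ℕ} (T : Fin d → Set (List ℕ)) (n : ℕ) : Set (Fin d → List ℕ) :=
  {v | ∀ i, v i ∈ level (T i) n}

/-- The level product `⊗T = ⋃_n ⊗T(n)`. -/
def levelProd {d : ℕ} (T : Fin d → Set (List ℕ)) : Set (Fin d → List ℕ) :=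
  ⋃ n, vecLevel T n

/-- `r` is the root tuple of the vector tree `T`. -/
def IsRoot {d : ℕ} (T : Fin d → Set (List ℕ)) (r : Fin d → List ℕ) : Prop :=
  ∀ i, level (T i) 0 = {r i}

/-- `F` is a vector fan of `T`: `F = (R_1(0) ∪ R_1(1), …, R_d(0) ∪ R_d(1))` for some
vector strong subtree `R` of `T`. -/
def IsVecFan {d : ℕ} (T F : Fin d → Set (List ℕ)) : Prop :=
  ∃ R : Fin d → Set (List ℕ), IsVecStrongSubtree T R ∧
    ∀ i, F i = level (R i) 0 ∪ level (R i) 1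

/-- `fan(T,n)`: the vector fans of `T` with `⊗F(1) ⊆ ⊗T(n)`. -/
def fanAt {d : ℕ} (T : Fin d → Set (List ℕ)) (n : ℕ) : Set (Fin d → Set (List ℕ)) :=
  {F | IsVecFan T F ∧ vecLevel F 1 ⊆ vecLevel T n}

/-- Density of `F ⊆ W(n)` in the `n`-th level of `W`. -/
noncomputable def dens (W : Set (List ℕ)) (n : ℕ) (F : Set (List ℕ)) : ℝ :=
  (F.ncard : ℝ) / ((level W n).ncard : ℝ)

/-- Density of `F ⊆ W(n)` relative to the node `w`. -/
noncomputable def densRel (W : Set (List ℕ)) (n : ℕ) (F : Set (List ℕ)) (w : List ℕ) : ℝ :=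
  ((F ∩ suc W w).ncard : ℝ) / ((level W n ∩ suc W w).ncard : ℝ)

/-- `s = w ⌢_W p`: `s` is the immediate successor of `w` in `W` such that the
concatenation `w ⌢ p` is an initial segment of `s`. -/
def IsConcat (W : Set (List ℕ)) (w : List ℕ) (p : ℕ) (s : List ℕ) : Prop :=
  ImmSuc W w s ∧ w ++ [p] <+: s

/-- The density Halpern–Läuchli statement in dimension `d`. -/
def DHL (d : ℕ) : Prop :=
  ∀ (b : Fin d → ℕ) (T : Fin d → Set (List ℕ)), IsVecHomogeneous b T →
    ∀ D : Set (Fin d → List ℕ), D ⊆ levelProd T →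
      0 < Filter.limsup
          (fun n => ((D ∩ vecLevel T n).ncard : ℝ) / ((vecLevel T n).ncard : ℝ)) atTop →
      ∃ S : Fin d → Set (List ℕ), IsVecStrongSubtree T S ∧ levelProd S ⊆ D

/-- `D : ⊗T → 2^W` is an `ε`-dense level selection along the strictly increasing
sequence `l`: for every `n` and every `t⃗ ∈ ⊗T(n)`, `D(t⃗) ⊆ W(l n)` and
`dens(D(t⃗)) ≥ ε`. -/
def IsDenseLevelSel {d : ℕ} (T : Fin d → Set (List ℕ)) (W : Set (List ℕ)) (l : ℕ → ℕ)
    (ε : ℝ) (D : (Fin d → List ℕ) → Set (List ℕ)) : Prop :=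
  StrictMono l ∧ ∀ n, ∀ v ∈ vecLevel T n, D v ⊆ level W (l n) ∧ ε ≤ dens W (l n) (D v)

/-- The pair `(R, w)` (`R` a vector strong subtree of `T` with root tuple `r0`) is strongly
`θ`-correlated with respect to the dense level selection `D` (with level sequence `l`):
`w ∈ D(r0)` and for every vector fan `F` of `R` with `F(0) = r0` and every `p < b_W`,
`dens(⋂_{r ∈ ⊗F(1)} D(r) | w ⌢_W p) ≥ θ`. -/
def StronglyCorrelated {d : ℕ} (T : Fin d → Set (List ℕ)) (W : Set (List ℕ)) (bW : ℕ)
    (l : ℕ → ℕ) (D : (Fin d → List ℕ) → Set (List ℕ)) (R : Fin d → Set (List ℕ))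
    (r0 : Fin d → List ℕ) (w : List ℕ) (θ : ℝ) : Prop :=
  w ∈ D r0 ∧
    ∀ F : Fin d → Set (List ℕ), IsVecFan R F → IsRoot F r0 →
      ∀ n, vecLevel F 1 ⊆ vecLevel T n →
        ∀ p < bW, ∀ s, IsConcat W w p s →
          θ ≤ densRel W (l n) (⋂ r ∈ vecLevel F 1, D r) s

section Ultrafilters

attribute [local instance] Ultrafilter.semigroup

/-- In a compact right topological semigroup every principal left ideal contains an idempotent
which belongs to a minimal left ideal. -/
theorem exists_minimal_idempotent {M : Type*} [Semigroup M] [TopologicalSpace M] [CompactSpace M]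
    [T2Space M] (hc : ∀ r : M, Continuous (· * r)) (t : M) :
    ∃ e : M, e * e = e ∧ (∃ a, e = a * t) ∧ ∀ r, ∃ r', r' * (r * e) = e := by
  let S : Set (Set M) := {I | IsClosed I ∧ I.Nonempty ∧ ∀ r, ∀ x ∈ I, r * x ∈ I}
  have hrange : ∀ x : M, Set.range (· * x) ∈ S := fun x =>
    ⟨(isCompact_range (hc x)).isClosed, ⟨_, ⟨x, rfl⟩⟩, by
      rintro r _ ⟨y, rfl⟩; exact ⟨r * y, mul_assoc _ _ _⟩⟩
  obtain ⟨I, hIt, hI⟩ := zorn_superset_nonempty S (by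
    intro c hcS hchain hne
    refine ⟨⋂₀ c, ⟨isClosed_sInter fun s hs => (hcS hs).1, ?_, ?_⟩,
      fun s hs => Set.sInter_subset_of_mem hs⟩
    · have : Nonempty c := hne.to_subtype
      exact IsCompact.nonempty_sInter_of_directed_nonempty_isCompact_isClosed
        (IsChain.directedOn hchain.symm)
        (fun s hs => (hcS hs).2.1) (fun s hs => (hcS hs).1.isCompact) (fun s hs => (hcS hs).1)
    · exact fun r x hx s hs => (hcS hs).2.2 r x (hx s hs)) _ (hrange t)
  obtain ⟨hIc, hIne, hImul⟩ := hI.prop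
  obtain ⟨e, heI, he⟩ := exists_idempotent_in_compact_subsemigroup hc I hIne hIc.isCompact
    (fun x _ y hy => hImul x y hy)
  refine ⟨e, he, ?_, fun r => ?_⟩
  · obtain ⟨a, ha⟩ := hIt heI
    exact ⟨a, ha.symm⟩
  · have hsub : Set.range (· * (r * e)) ⊆ I := by
      rintro _ ⟨y, rfl⟩
      exact hImul _ _ (hImul _ _ heI)
    exact hI.le_of_le (hrange _) hsub heI

theorem ultrafilter_map_mul {M N : Type*} [Semigroup M] [Semigroup N] (f : M →ₙ* N)
    (U V : Ultrafilter M) : (U * V).map f = U.map f * V.map f := by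
  apply Ultrafilter.coe_inj.mp
  refine Filter.ext' fun p => ?_
  change (∀ᶠ m in ↑(U * V), p (f m)) ↔ ∀ᶠ m in (U.map f : Filter N), ∀ᶠ m' in (V.map f : Filter N), p (m * m')
  rw [Ultrafilter.eventually_mul]
  simp [Filter.eventually_map]

theorem ultrafilter_map_pure {M N : Type*} (f : M → N) (x : M) :
    (pure x : Ultrafilter M).map f = pure (f x) := by
  apply Ultrafilter.coe_inj.mp
  simp

/-- Substitution of the letter `a` for the variable `none`. -/
def subst {A : Type*} (a : A) (z : List (Option A)) : List A := z.map (·.getD a)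

/-- The substitution of a letter, as a homomorphism of free monoids. -/
def substHom {A : Type*} (a : A) : FreeMonoid (Option A) →ₙ* FreeMonoid A :=
  (FreeMonoid.map fun o : Option A => o.getD a : FreeMonoid (Option A) →* FreeMonoid A)

theorem exists_ultrafilter_fixed (A : Type*) :
    ∃ (w : Ultrafilter (FreeMonoid A)) (q : Ultrafilter (FreeMonoid (Option A))), ∀ a : A,
      w * (pure (FreeMonoid.of a) * (q.map (substHom a) * w)) = w := by
  obtain ⟨w, hw, -, hwmin⟩ := exists_minimal_idempotent
    (Ultrafilter.continuous_mul_left (M := FreeMonoid A)) (pure 1)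
  let ι : FreeMonoid A →ₙ* FreeMonoid (Option A) :=
    (FreeMonoid.map some : FreeMonoid A →* FreeMonoid (Option A))
  set W := w.map ι with hWdef
  have hW : W * W = W := by rw [hWdef, ← ultrafilter_map_mul, hw]
  obtain ⟨e, he, ⟨a₀, ha₀⟩, hemin⟩ := exists_minimal_idempotent
    (Ultrafilter.continuous_mul_left (M := FreeMonoid (Option A))) W
  have heW : e * W = e := by rw [ha₀, mul_assoc, hW]
  set x := W * e with hx
  have hxx : x * x = x := by
    rw [hx, mul_assoc, ← mul_assoc e, heW, he]
  have hWx : W * x = x := by rw [hx, ← mul_assoc, hW]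
  have hxW : x * W = x := by rw [hx, mul_assoc, heW]
  have hxmin : ∀ r, ∃ r', r' * (r * x) = x := by
    intro r
    obtain ⟨r', hr'⟩ := hemin (r * W)
    exact ⟨W * r', by rw [mul_assoc, hx, ← mul_assoc r, hr']⟩
  have hφW : ∀ a, W.map (substHom a) = w := by
    intro a
    rw [hWdef, Ultrafilter.map_map]
    convert Ultrafilter.map_id w
    ext1 y
    change FreeMonoid.map _ (FreeMonoid.map some y) = y
    rw [FreeMonoid.map_map]
    exact DFunLike.congr_fun FreeMonoid.map_id y
  have hφx : ∀ a, x.map (substHom a) = w := by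
    intro a
    set f := x.map (substHom a) with hf
    have h1 : f * f = f := by rw [hf, ← ultrafilter_map_mul, hxx]
    have h2 : w * f = f := by rw [← hφW a, hf, ← ultrafilter_map_mul, hWx]
    have h3 : f * w = f := by rw [← hφW a, hf, ← ultrafilter_map_mul, hxW]
    obtain ⟨r, hr⟩ := hwmin f
    rw [h3] at hr
    rw [← h2]
    nth_rw 1 [← hr]
    rw [mul_assoc, h1, hr]
  set v : Ultrafilter (FreeMonoid (Option A)) := pure (FreeMonoid.of none) with hv
  clear_value x
  obtain ⟨k, hxk, hk⟩ : ∃ k, x * k = k ∧ (x * v * x) * k = x := by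
    set h := x * v * x with hh
    have hxh : x * h = h := by rw [hh, ← mul_assoc, ← mul_assoc, hxx]
    have hhx : h * x = h := by rw [hh, mul_assoc, hxx]
    obtain ⟨r₁, h₁⟩ := hxmin (x * v)
    rw [← hh] at h₁
    set k := x * r₁ * x with hkdef
    have hxk : x * k = k := by rw [hkdef, ← mul_assoc, ← mul_assoc, hxx]
    have hkx : k * x = k := by rw [hkdef, mul_assoc, hxx]
    have hkh : k * h = x := by rw [hkdef, mul_assoc, hxh, mul_assoc, h₁, hxx]
    obtain ⟨r₂, h₂⟩ := hxmin k
    rw [hkx] at h₂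
    have hk₂ : x * r₂ * x * k = x := by rw [mul_assoc, hxk, mul_assoc, h₂, hxx]
    have : h = x * r₂ * x := by
      calc h = x * h := hxh.symm
        _ = x * r₂ * x * k * h := by rw [hk₂]
        _ = x * r₂ * x * x := by rw [mul_assoc _ k, hkh]
        _ = x * r₂ * x := by rw [mul_assoc _ x x, hxx]
    exact ⟨k, hxk, by rw [this, hk₂]⟩
  refine ⟨w, k, fun a => ?_⟩
  have := congrArg (Ultrafilter.map (substHom a)) hk
  rw [mul_assoc, hxk, ultrafilter_map_mul, ultrafilter_map_mul, hφx, hv,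
    ultrafilter_map_pure] at this
  change w * pure (FreeMonoid.of a) * _ = w at this
  rw [← mul_assoc, ← mul_assoc, this, hw]

/-- There is an ultrafilter on the words over a finite alphabet each of whose members admits the
basic step in the construction of a Carlson–Simpson subspace. -/
theorem exists_ultrafilter_step (A : Type*) [Finite A] :
    ∃ w : Ultrafilter (List A), ∀ P ∈ w, ∃ u ∈ P, ∃ z : List (Option A),
      {u' | ∀ a, u ++ (a :: subst a z) ++ u' ∈ P} ∈ w := by
  obtain ⟨w', q', h⟩ := exists_ultrafilter_fixed A
  let w : Ultrafilter (List A) := w'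
  let q : Ultrafilter (List (Option A)) := q'
  refine ⟨w, fun P hP => ?_⟩
  have h1 : ∀ a, ∀ᶠ u in (w : Filter (List A)), ∀ᶠ z in (q : Filter (List (Option A))),
      ∀ᶠ u' in (w : Filter (List A)), u ++ (a :: subst a z) ++ u' ∈ P := by
    intro a
    have hP' : P ∈ (w' * (pure (FreeMonoid.of a) * (q'.map (substHom a) * w')) :
        Ultrafilter (FreeMonoid A)) := by rw [h a]; exact hP
    have hu : ∀ᶠ u in (w : Filter (List A)), ∀ᶠ z in (q : Filter (List (Option A))),
      ∀ᶠ u' in (w : Filter (List A)), u ++ (a :: (subst a z ++ u')) ∈ P := hP'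
    simpa using hu
  have h2 := Filter.eventually_all.2 h1
  obtain ⟨u, huP, hu⟩ := (Filter.Eventually.and (f := (w : Filter (List A))) hP h2).exists
  obtain ⟨z, hz⟩ := (Filter.eventually_all.2 hu).exists
  exact ⟨u, huP, z, Filter.eventually_all.2 hz⟩

/-- The word obtained from `x` by substituting its letters successively into the variable words
`none :: z₀, none :: z₁, …`, with first word `u`. -/
def subspaceMap {A : Type*} (u : List A) (z : ℕ → List (Option A)) : List A → List A :=
  fun x => u ++ (x.zipIdx.flatMap fun p => p.1 :: subst p.1 (z p.2))

theorem subspaceMap_nil {A : Type*} (u : List A) (z : ℕ → List (Option A)) :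
    subspaceMap u z [] = u := by simp [subspaceMap]

theorem subspaceMap_concat {A : Type*} (u : List A) (z : ℕ → List (Option A)) (x : List A)
    (a : A) : subspaceMap u z (x ++ [a]) = subspaceMap u z x ++ a :: subst a (z x.length) := by
  simp [subspaceMap, List.zipIdx_append]

/-- The **Carlson–Simpson theorem** for left variable words. -/
theorem exists_subspace_monochromatic (A : Type*) [Finite A] {K : Type*} [Finite K]
    (χ : List A → K) : ∃ (u : List A) (z : ℕ → List (Option A)) (κ : K),
      ∀ x, χ (subspaceMap u z x) = κ := by
  obtain ⟨w, hw⟩ := exists_ultrafilter_step A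
  obtain ⟨κ, hκ⟩ : ∃ κ, {u | χ u = κ} ∈ w := by
    have : ∀ᶠ u in (w : Filter (List A)), ∃ κ, χ u = κ := Eventually.of_forall fun u => ⟨_, rfl⟩
    exact Ultrafilter.eventually_exists_iff.1 this
  choose! u hu z hz using hw
  let P : ℕ → Set (List A) := fun n =>
    n.rec {u | χ u = κ} fun _ Q => {u' | ∀ a, u Q ++ (a :: subst a (z Q)) ++ u' ∈ Q}
  have hP : ∀ n, P n ∈ w := by
    intro n
    induction n with
    | zero => exact hκ
    | succ n ih => exact hz _ ih
  refine ⟨u (P 0), fun n => z (P n) ++ (u (P (n + 1))).map some, κ, fun x => ?_⟩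
  set Φ := subspaceMap (u (P 0)) (fun n => z (P n) ++ (u (P (n + 1))).map some) with hΦ
  have key : ∀ x : List A, ∃ y, Φ x = y ++ u (P x.length) ∧ ∀ u' ∈ P x.length, y ++ u' ∈ P 0 := by
    intro x
    induction x using List.reverseRecOn with
    | nil => exact ⟨[], by simp [hΦ, subspaceMap_nil], by simp⟩
    | append_singleton x a ih =>
      obtain ⟨y, hy, hy'⟩ := ih
      refine ⟨y ++ (u (P x.length) ++ a :: subst a (z (P x.length))), ?_, ?_⟩
      · rw [hΦ, subspaceMap_concat, ← hΦ, hy]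
        simp [subst, Function.comp_def]
      · intro u' hu'
        rw [List.length_append] at hu'
        rw [List.append_assoc]
        exact hy' _ (hu' a)
  obtain ⟨y, hy, hy'⟩ := key x
  rw [hy]
  exact hy' _ (hu _ (hP _))

end Ultrafilters

/-- `g` is a strong embedding of the tree of words over `Fin b` into itself with level map `h`. -/
def IsStrongEmb {b : ℕ} (h : ℕ → ℕ) (g : List (Fin b) → List (Fin b)) : Prop :=
  (∀ u, (g u).length = h u.length) ∧ ∀ u p, g u ++ [p] <+: g (u ++ [p])

/-- The node of `b^{<ℕ}` coded by the word `g u`. -/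
def node {b : ℕ} (g : List (Fin b) → List (Fin b)) (u : List (Fin b)) : List ℕ :=
  (g u).map Fin.val

theorem isStrongEmb_id (b : ℕ) : IsStrongEmb (b := b) id id :=
  ⟨fun _ => rfl, fun _ _ => List.prefix_refl _⟩

theorem IsStrongEmb.prefix_mono {b : ℕ} {h : ℕ → ℕ} {g : List (Fin b) → List (Fin b)}
    (hg : IsStrongEmb h g) {u v : List (Fin b)} (huv : u <+: v) : g u <+: g v := by
  obtain ⟨t, rfl⟩ := huv
  induction t using List.reverseRecOn with
  | nil => simp
  | append_singleton t a ih =>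
    rw [← List.append_assoc]
    exact ih.trans ((List.prefix_append _ _).trans (hg.2 _ _))

theorem IsStrongEmb.strictMono {b : ℕ} (hb : 0 < b) {h : ℕ → ℕ} {g : List (Fin b) → List (Fin b)}
    (hg : IsStrongEmb h g) : StrictMono h := by
  refine strictMono_nat_of_lt_succ fun n => ?_
  have h1 := (hg.2 (List.replicate n ⟨0, hb⟩) ⟨0, hb⟩).length_le
  simpa [hg.1] using h1

theorem IsStrongEmb.eq_of_eq {b : ℕ} {h : ℕ → ℕ} {g : List (Fin b) → List (Fin b)}
    (hg : IsStrongEmb h g) {u v : List (Fin b)} (hl : u.length = v.length) (huv : g u = g v) :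
    u = v := by
  induction u using List.reverseRecOn generalizing v with
  | nil => exact (List.length_eq_zero_iff.1 hl.symm).symm
  | append_singleton u p ih =>
    rcases List.eq_nil_or_concat v with rfl | ⟨v, q, rfl⟩
    · simp at hl
    · rw [List.concat_eq_append] at *
      have hl' : u.length = v.length := by simpa using hl
      have h1 := hg.2 u p
      rw [huv] at h1
      have h2 := List.prefix_of_prefix_length_le h1 (hg.2 v q) (by simp [hg.1, hl'])
      have h3 := h2.eq_of_length (by simp [hg.1, hl'])
      obtain ⟨h4, h5⟩ := List.append_inj h3 (by simp [hg.1, hl'])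
      rw [ih hl' h4, h5]

theorem IsStrongEmb.prefix_iff {b : ℕ} (hb : 0 < b) {h : ℕ → ℕ} {g : List (Fin b) → List (Fin b)}
    (hg : IsStrongEmb h g) {u v : List (Fin b)} : g u <+: g v ↔ u <+: v := by
  refine ⟨fun huv => ?_, hg.prefix_mono⟩
  have hle : u.length ≤ v.length := by
    have := huv.length_le
    rw [hg.1, hg.1] at this
    exact (hg.strictMono hb).le_iff_le.1 this
  have h1 : g (v.take u.length) <+: g v := hg.prefix_mono (List.take_prefix _ _)
  have hl : (v.take u.length).length = u.length := by simp [hle]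
  have h2 := (List.prefix_of_prefix_length_le huv h1 (by rw [hg.1, hg.1, hl])).eq_of_length
    (by rw [hg.1, hg.1, hl])
  rw [hg.eq_of_eq hl.symm h2]
  exact List.take_prefix _ _

theorem IsStrongEmb.comp {b : ℕ} {h k : ℕ → ℕ} {g f : List (Fin b) → List (Fin b)}
    (hg : IsStrongEmb h g) (hf : IsStrongEmb k f) : IsStrongEmb (h ∘ k) (g ∘ f) :=
  ⟨fun u => by simp [hg.1, hf.1],
    fun u p => (hg.2 (f u) p).trans (hg.prefix_mono (hf.2 u p))⟩

theorem map_val_prefix_iff {b : ℕ} {u v : List (Fin b)} :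
    u.map Fin.val <+: v.map Fin.val ↔ u <+: v := by
  refine ⟨fun huv => ?_, fun huv => huv.map _⟩
  have hle : u.length ≤ v.length := by simpa using huv.length_le
  have h1 : (v.take u.length).map Fin.val <+: v.map Fin.val := (List.take_prefix _ _).map _
  have h2 := (List.prefix_of_prefix_length_le huv h1 (by simp [hle])).eq_of_length
    (by simp [hle])
  rw [List.map_injective_iff.2 Fin.val_injective h2]
  exact List.take_prefix _ _

theorem IsStrongEmb.node_prefix_iff {b : ℕ} (hb : 0 < b) {h : ℕ → ℕ}
    {g : List (Fin b) → List (Fin b)} (hg : IsStrongEmb h g) {u v : List (Fin b)} :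
    node g u <+: node g v ↔ u <+: v :=
  map_val_prefix_iff.trans (hg.prefix_iff hb)

theorem IsStrongEmb.node_injective {b : ℕ} (hb : 0 < b) {h : ℕ → ℕ}
    {g : List (Fin b) → List (Fin b)} (hg : IsStrongEmb h g) : Function.Injective (node g) := by
  intro u v huv
  have h1 := (hg.node_prefix_iff hb).1 (huv ▸ List.prefix_refl _ : node g u <+: node g v)
  have h2 := (hg.node_prefix_iff hb).1 (huv ▸ List.prefix_refl _ : node g v <+: node g u)
  exact h1.eq_of_length (le_antisymm h1.length_le h2.length_le)

theorem ncard_strict_prefixes {α : Type*} (u : List α) :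
    {v | v <+: u ∧ v ≠ u}.ncard = u.length := by
  have : {v | v <+: u ∧ v ≠ u} = (fun k => u.take k) '' (Finset.range u.length : Set ℕ) := by
    ext v
    simp only [Set.mem_ofPred_eq, Finset.coe_range, Set.mem_image, Set.mem_Iio]
    constructor
    · rintro ⟨h1, h2⟩
      refine ⟨v.length, ?_, (List.prefix_iff_eq_take.1 h1).symm⟩
      exact lt_of_le_of_ne h1.length_le fun h => h2 (h1.eq_of_length h)
    · rintro ⟨k, hk, rfl⟩
      refine ⟨List.take_prefix _ _, fun h => ?_⟩
      have := congrArg List.length h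
      simp at this
      omega
  rw [this, Set.InjOn.ncard_image, Set.ncard_coe_finset, Finset.card_range]
  intro i hi j hj hij
  have := congrArg List.length hij
  simp only [Finset.coe_range, Set.mem_Iio] at hi hj
  simp only [List.length_take] at this
  omega

theorem IsStrongEmb.level_eq {b : ℕ} (hb : 0 < b) {h : ℕ → ℕ} {g : List (Fin b) → List (Fin b)}
    (hg : IsStrongEmb h g) (n : ℕ) :
    level (Set.range (node g)) n = node g '' {u | u.length = n} := by
  have key : ∀ u, {s ∈ Set.range (node g) | s <+: node g u ∧ s ≠ node g u}.ncard = u.length := by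
    intro u
    rw [← ncard_strict_prefixes u, ← Set.ncard_image_of_injective _ (hg.node_injective hb)]
    congr 1
    ext s
    constructor
    · rintro ⟨⟨v, rfl⟩, h1, h2⟩
      exact ⟨v, ⟨(hg.node_prefix_iff hb).1 h1, fun h => h2 (h ▸ rfl)⟩, rfl⟩
    · rintro ⟨v, ⟨h1, h2⟩, rfl⟩
      exact ⟨⟨v, rfl⟩, (hg.node_prefix_iff hb).2 h1, fun h => h2 (hg.node_injective hb h)⟩
  ext s
  constructor
  · rintro ⟨⟨u, rfl⟩, hu⟩
    exact ⟨u, (key u).symm.trans hu, rfl⟩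
  · rintro ⟨u, hu, rfl⟩
    exact ⟨⟨u, rfl⟩, (key u).trans hu⟩

theorem exists_concat_prefix {α : Type*} {u v : List α} (huv : u <+: v) (hne : u ≠ v) :
    ∃ p, u ++ [p] <+: v := by
  obtain ⟨t, rfl⟩ := huv
  cases t with
  | nil => simp at hne
  | cons p t => exact ⟨p, t, by simp⟩

theorem IsStrongEmb.immSuc_iff {b : ℕ} (hb : 0 < b) {h : ℕ → ℕ} {g : List (Fin b) → List (Fin b)}
    (hg : IsStrongEmb h g) (u : List (Fin b)) (s : List ℕ) :
    ImmSuc (Set.range (node g)) (node g u) s ↔ ∃ p, s = node g (u ++ [p]) := by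
  constructor
  · rintro ⟨-, ⟨v, rfl⟩, h1, h2, h3⟩
    obtain ⟨p, hp⟩ := exists_concat_prefix ((hg.node_prefix_iff hb).1 h1) (fun h => h2 (h ▸ rfl))
    refine ⟨p, ?_⟩
    rcases h3 (node g (u ++ [p])) ⟨_, rfl⟩ ((hg.node_prefix_iff hb).2 (List.prefix_append _ _))
      ((hg.node_prefix_iff hb).2 hp) with h4 | h4
    · simpa using hg.node_injective hb h4
    · exact h4.symm
  · rintro ⟨p, rfl⟩
    refine ⟨⟨_, rfl⟩, ⟨_, rfl⟩, (hg.node_prefix_iff hb).2 (List.prefix_append _ _), fun h => ?_, ?_⟩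
    · simpa using hg.node_injective hb h
    · rintro _ ⟨v, rfl⟩ h1 h2
      rw [hg.node_prefix_iff hb] at h1 h2
      by_cases hv : u = v
      · exact Or.inl (hv ▸ rfl)
      · obtain ⟨q, hq⟩ := exists_concat_prefix h1 hv
        have h3 := hq.length_le
        have h4 := h2.length_le
        right
        rw [h2.eq_of_length (by simp at *; omega)]

theorem range_node_id (b : ℕ) : Set.range (node (b := b) id) = bSeq b := by
  have h := Set.range_list_map (Fin.val : Fin b → ℕ)
  simp only [Fin.range_val, Set.mem_Iio] at h
  exact h

theorem IsStrongEmb.isStrongSubtreeWith {b : ℕ} (hb : 0 < b) {h k : ℕ → ℕ}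
    {g f : List (Fin b) → List (Fin b)} (hg : IsStrongEmb h g) (hf : IsStrongEmb k f) :
    IsStrongSubtreeWith (Set.range (node g)) (Set.range (node (g ∘ f))) k := by
  have hgf := hg.comp hf
  refine ⟨?_, ?_, hf.strictMono hb, ?_, ?_⟩
  · rintro _ ⟨u, rfl⟩
    exact ⟨f u, rfl⟩
  · refine ⟨node (g ∘ f) [], ?_, ?_⟩
    · simp only [hgf.level_eq hb]
      exact ⟨[], rfl, rfl⟩
    · intro r hr
      rw [hgf.level_eq hb] at hr
      obtain ⟨u, hu, rfl⟩ := hr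
      rw [List.length_eq_zero_iff.1 hu]
  · intro n
    rw [hgf.level_eq hb, hg.level_eq hb]
    rintro _ ⟨u, hu, rfl⟩
    exact ⟨f u, by simp only [Set.mem_ofPred_eq] at hu ⊢; rw [hf.1, hu], rfl⟩
  · rintro _ ⟨u, rfl⟩ t ht
    obtain ⟨p, rfl⟩ := (hg.immSuc_iff hb (f u) t).1 ht
    refine ⟨node (g ∘ f) (u ++ [p]), ⟨(hgf.immSuc_iff hb _ _).2 ⟨p, rfl⟩,
      (hg.node_prefix_iff hb).2 (hf.2 u p)⟩, ?_⟩
    rintro s ⟨hs, hps⟩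
    obtain ⟨q, rfl⟩ := (hgf.immSuc_iff hb _ _).1 hs
    have h1 := List.prefix_of_prefix_length_le ((hg.node_prefix_iff hb).1 hps) (hf.2 u q) (by simp)
    have h2 := h1.eq_of_length (by simp)
    simp only [List.append_cancel_left_eq, List.cons.injEq, and_true] at h2
    rw [h2]

theorem finite_prefixes (T : Set (List ℕ)) (t : List ℕ) : {s ∈ T | s <+: t ∧ s ≠ t}.Finite := by
  refine Set.Finite.subset (s := (t.inits.toFinset : Set (List ℕ))) (Finset.finite_toSet _) ?_
  rintro s ⟨-, hs, -⟩
  simpa using hs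

theorem ImmSuc.mem_level {S : Set (List ℕ)} {s t : List ℕ} (hst : ImmSuc S s t) {n : ℕ}
    (hs : s ∈ level S n) : t ∈ level S (n + 1) := by
  obtain ⟨h1, h2, h3, h4, h5⟩ := hst
  refine ⟨h2, ?_⟩
  have : {u ∈ S | u <+: t ∧ u ≠ t} = insert s {u ∈ S | u <+: s ∧ u ≠ s} := by
    ext u
    constructor
    · rintro ⟨hu, hut, hne⟩
      rcases List.prefix_or_prefix_of_prefix hut h3 with h | h
      · by_cases hus : u = s
        · exact Or.inl hus
        · exact Or.inr ⟨hu, h, hus⟩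
      · rcases h5 u hu h hut with h | h
        · exact Or.inl h
        · exact (hne h).elim
    · rintro (rfl | ⟨hu, hus, hne⟩)
      · exact ⟨h1, h3, h4⟩
      · refine ⟨hu, hus.trans h3, ?_⟩
        rintro rfl
        exact h4 (h3.eq_of_length (le_antisymm h3.length_le hus.length_le))
  rw [this, Set.ncard_insert_of_notMem (by simp) (finite_prefixes S s), hs.2]

theorem exists_immSuc_of_mem_level_ne_zero {S : Set (List ℕ)} {t : List ℕ} (ht : t ∈ S)
    (h0 : t ∉ level S 0) : ∃ s, ImmSuc S s t := by
  have hne : {s ∈ S | s <+: t ∧ s ≠ t}.Nonempty := by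
    rw [Set.nonempty_iff_ne_empty]
    intro h
    exact h0 ⟨ht, by rw [h, Set.ncard_empty]⟩
  obtain ⟨s, ⟨hs, hst, hne'⟩, hmax⟩ := Set.exists_max_image _ List.length (finite_prefixes S t) hne
  refine ⟨s, hs, ht, hst, hne', fun u hu hsu hut => ?_⟩
  by_cases h : u = t
  · exact Or.inr h
  · exact Or.inl (hsu.eq_of_length (le_antisymm hsu.length_le (hmax u ⟨hu, hut, h⟩))).symm

/-- Every strong subtree of a homogeneous tree is the range of a strong embedding. -/
theorem IsStrongSubtreeWith.exists_isStrongEmb {b : ℕ} (hb : 0 < b) {h k : ℕ → ℕ}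
    {g : List (Fin b) → List (Fin b)} (hg : IsStrongEmb h g) {S : Set (List ℕ)}
    (hS : IsStrongSubtreeWith (Set.range (node g)) S k) :
    ∃ f, IsStrongEmb k f ∧ S = Set.range (node (g ∘ f)) := by
  obtain ⟨hsub, ⟨r, hr, hruniq⟩, hk, hlev, hsuc⟩ := hS
  obtain ⟨u₀, rfl⟩ := hsub hr.1
  have hstep : ∀ (x : List (Fin b)) (p : Fin b), ∃ y, node g x ∈ S →
      ImmSuc S (node g x) (node g y) ∧ x ++ [p] <+: y ∧
      ∀ s, ImmSuc S (node g x) s → node g (x ++ [p]) <+: s → s = node g y := by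
    intro x p
    by_cases hx : node g x ∈ S
    · obtain ⟨s, ⟨hs, hps⟩, huniq⟩ := hsuc _ hx _ ((hg.immSuc_iff hb x _).2 ⟨p, rfl⟩)
      obtain ⟨y, rfl⟩ := hsub hs.2.1
      exact ⟨y, fun _ => ⟨hs, (hg.node_prefix_iff hb).1 hps, fun s h1 h2 => huniq s ⟨h1, h2⟩⟩⟩
    · exact ⟨[], fun h => (hx h).elim⟩
  choose F hF using hstep
  let f : List (Fin b) → List (Fin b) := fun u => u.foldl F u₀
  have hf : ∀ u p, f (u ++ [p]) = F (f u) p := fun u p => by simp [f]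
  have hmem : ∀ u, node g (f u) ∈ level S u.length := by
    intro u
    induction u using List.reverseRecOn with
    | nil => exact hr
    | append_singleton u p ih =>
      rw [hf, List.length_append]
      exact ((hF (f u) p ih.1).1).mem_level ih
  refine ⟨f, ⟨fun u => ?_, fun u p => ?_⟩, ?_⟩
  · have := hlev _ (hmem u)
    rw [hg.level_eq hb] at this
    obtain ⟨v, hv, hvu⟩ := this
    rw [← hg.node_injective hb hvu]
    exact hv
  · rw [hf]
    exact (hF (f u) p (hmem u).1).2.1
  · refine subset_antisymm ?_ ?_
    · intro s
      induction hn : s.length using Nat.strong_induction_on generalizing s with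
      | _ n ih =>
        intro hs
        by_cases h0 : s ∈ level S 0
        · exact ⟨[], (hruniq s h0).symm⟩
        · obtain ⟨t, ht⟩ := exists_immSuc_of_mem_level_ne_zero hs h0
          have hlt : t.length < s.length := lt_of_le_of_ne ht.2.2.1.length_le
            fun h => ht.2.2.2.1 (ht.2.2.1.eq_of_length h)
          obtain ⟨u, rfl⟩ := ih _ (hn ▸ hlt) rfl ht.1
          obtain ⟨v, rfl⟩ := hsub hs
          change ImmSuc S (node g (f u)) (node g v) at ht
          obtain ⟨p, hp⟩ := exists_concat_prefix ((hg.node_prefix_iff hb).1 ht.2.2.1)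
            (fun h => ht.2.2.2.1 (congrArg (node g) h))
          refine ⟨u ++ [p], ?_⟩
          rw [(hF (f u) p (hmem u).1).2.2 _ ht ((hg.node_prefix_iff hb).2 hp), ← hf]
          rfl
    · rintro _ ⟨u, rfl⟩
      exact (hmem u).1

theorem IsHomogeneous.exists_isStrongEmb {b : ℕ} {T : Set (List ℕ)} (hT : IsHomogeneous b T) :
    ∃ h g, IsStrongEmb (b := b) h g ∧ T = Set.range (node g) := by
  obtain ⟨hb, h, hT⟩ := hT
  rw [← range_node_id] at hT
  obtain ⟨g, hg, rfl⟩ := hT.exists_isStrongEmb (by omega) (isStrongEmb_id b)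
  exact ⟨h, g, hg, rfl⟩

theorem map_subspaceMap {A B : Type*} (π : A → B) (u : List A) (z : ℕ → List (Option A))
    (x : List A) : (subspaceMap u z x).map π =
      subspaceMap (u.map π) (fun n => (z n).map (Option.map π)) (x.map π) := by
  have hs : ∀ a (y : List (Option A)), (subst a y).map π = subst (π a) (y.map (Option.map π)) := by
    intro a y
    simp only [subst, List.map_map]
    congr 1
    funext o
    cases o <;> rfl
  induction x using List.reverseRecOn with
  | nil => simp [subspaceMap_nil]
  | append_singleton x a ih =>
    rw [subspaceMap_concat, List.map_append, ih, List.map_append, List.map_singleton,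
      subspaceMap_concat, List.map_cons, hs, List.length_map]

theorem length_subspaceMap {A : Type*} (u : List A) (z : ℕ → List (Option A)) (x : List A) :
    (subspaceMap u z x).length = u.length + ∑ i ∈ Finset.range x.length, ((z i).length + 1) := by
  induction x using List.reverseRecOn with
  | nil => simp [subspaceMap_nil]
  | append_singleton x a ih =>
    rw [subspaceMap_concat, List.length_append, ih, List.length_append, List.length_singleton,
      Finset.sum_range_succ, List.length_cons, subst, List.length_map]
    omega

/-- A form of the **Halpern–Läuchli theorem**: the colouring depends on a choice of nodes at a
common level, one above each node at level `J` of each of the trees, and the homogeneous vector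
strong subtree contains the first `J` levels. -/
theorem exists_strongEmb_homogeneous {d : ℕ} (b : Fin d → ℕ) (J : ℕ) {K : Type*} [Finite K]
    (χ : (∀ i, List.Vector (Fin (b i)) J → List (Fin (b i))) → K) :
    ∃ (k : ℕ → ℕ) (f : ∀ i, List (Fin (b i)) → List (Fin (b i))) (κ : K),
      (∀ i, IsStrongEmb k (f i)) ∧ (∀ i u, u.length < J → f i u = u) ∧
      ∀ n (x : ∀ i, List.Vector (Fin (b i)) J → List (Fin (b i))),
        (∀ i q, (x i q).length = n) → χ (fun i q => f i (q.1 ++ x i q)) = κ := by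
  obtain ⟨u, z, κ, hκ⟩ := exists_subspace_monochromatic
    (∀ i, List.Vector (Fin (b i)) J → Fin (b i))
    (fun X => χ fun i q => q.1 ++ X.map fun a => a i q)
  let τ : ∀ i, List.Vector (Fin (b i)) J → List (Fin (b i)) → List (Fin (b i)) := fun i q =>
    subspaceMap (u.map fun a => a i q) (fun n => (z n).map (Option.map fun a => a i q))
  let f : ∀ i, List (Fin (b i)) → List (Fin (b i)) := fun i v =>
    if hv : J ≤ v.length then
      v.take J ++ τ i ⟨v.take J, by simp [hv]⟩ (v.drop J) else v
  have hf₁ : ∀ i v, v.length < J → f i v = v := fun i v hv => dif_neg (by omega)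
  have hf₂ : ∀ i (q : List.Vector (Fin (b i)) J) x, f i (q.1 ++ x) = q.1 ++ τ i q x := by
    intro i q x
    obtain ⟨q, rfl⟩ := q
    simp [f]
  let k : ℕ → ℕ := fun n =>
    if J ≤ n then J + (u.length + ∑ i ∈ Finset.range (n - J), ((z i).length + 1)) else n
  have hsplit : ∀ i (v : List (Fin (b i))), J ≤ v.length →
      ∃ (q : List.Vector (Fin (b i)) J) (x : _), v = q.1 ++ x := fun i v hv =>
    ⟨⟨v.take J, by simp [hv]⟩, v.drop J, (List.take_append_drop J v).symm⟩
  refine ⟨k, f, κ, fun i => ⟨fun v => ?_, fun v p => ?_⟩, hf₁, ?_⟩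
  · by_cases hv : J ≤ v.length
    · obtain ⟨q, x, rfl⟩ := hsplit i v hv
      rw [hf₂]
      simp [k, τ, length_subspaceMap, q.2]
    · rw [hf₁ i v (by omega)]
      simp [k, hv]
  · by_cases hv : J ≤ v.length
    · obtain ⟨q, x, rfl⟩ := hsplit i v hv
      rw [List.append_assoc, hf₂, hf₂]
      simp only [τ, subspaceMap_concat]
      exact ⟨subst p ((z x.length).map (Option.map fun a => a i q)), by simp⟩
    · rw [hf₁ i v (by omega)]
      by_cases hv' : J ≤ (v ++ [p]).length
      · have hq := hf₂ i ⟨v ++ [p], by simp at *; omega⟩ []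
        simp only [List.append_nil] at hq
        rw [hq]
        exact List.prefix_append _ _
      · rw [hf₁ i _ (by omega)]
  · intro n x hx
    rw [← hκ (List.ofFn fun m : Fin n => fun i q => (x i q)[m]'(by simp [hx]))]
    congr 1
    funext i q
    rw [hf₂, map_subspaceMap]
    congr 2
    rw [List.map_ofFn]
    apply List.ext_getElem
    · simp [hx]
    · intro m h1 h2
      simp

open MeasureTheory Topology in
theorem exists_limit_measure {ι : Type*} [Countable ι] (Ω : ℕ → Type) [∀ k, Fintype (Ω k)]
    [∀ k, Nonempty (Ω k)] (E : ∀ k, ι → Set (Ω k)) :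
    ∃ ν : Measure (ι → Bool), IsProbabilityMeasure ν ∧ ∀ A : Finset ι,
      Tendsto (fun k => ({ω | ∀ t ∈ A, ω ∈ E k t}.ncard : ℝ) / Fintype.card (Ω k))
        (hyperfilter ℕ) (𝓝 (ν.real {x | ∀ t ∈ A, x t = true})) := by
  classical
  let μ : ℕ → ProbabilityMeasure (ι → Bool) := fun k =>
    ⟨((PMF.uniformOfFintype (Ω k)).map (fun ω t => decide (ω ∈ E k t))).toMeasure, inferInstance⟩
  obtain ⟨ν, -, hν⟩ := isCompact_univ.ultrafilter_le_nhds' ((hyperfilter ℕ).map μ) univ_mem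
  refine ⟨ν, inferInstance, fun A => ?_⟩
  have hclopen : IsClopen {x : ι → Bool | ∀ t ∈ A, x t = true} := by
    have : {x : ι → Bool | ∀ t ∈ A, x t = true} = ⋂ t ∈ A, (fun x => x t) ⁻¹' {true} := by
      ext x; simp
    rw [this]
    exact isClopen_biInter_finset fun t _ =>
      (isClopen_discrete {true}).preimage (continuous_apply t)
  have h := ProbabilityMeasure.tendsto_measure_of_isClopen_of_tendsto hν hclopen
  have h2 := (NNReal.tendsto_coe.2 h)
  refine Tendsto.congr (fun k => ?_) h2
  let _ : MeasurableSpace (Ω k) := ⊤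
  change (((PMF.uniformOfFintype (Ω k)).map (fun ω t => decide (ω ∈ E k t))).toMeasure
    {x : ι → Bool | ∀ t ∈ A, x t = true}).toReal = _
  rw [PMF.toMeasure_map_apply _ _ _ measurable_from_top hclopen.isOpen.measurableSet,
    PMF.toMeasure_uniformOfFintype_apply _ MeasurableSpace.measurableSet_top]
  simp [Set.ncard_eq_toFinset_card', Fintype.card_subtype, Set.preimage]

open MeasureTheory Topology in
theorem exists_limsup_density_pos {ι : Type*} [Countable ι] (ν : Measure (ι → Bool))
    [IsProbabilityMeasure ν] (L : ℕ → Finset ι) (hL : ∀ n, (L n).Nonempty) {η : ℝ} (hη : 0 < η)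
    (hν : ∀ n, ∀ t ∈ L n, η ≤ ν.real {x | x t = true}) {P : (ι → Bool) → Prop}
    (hP : ∀ᵐ x ∂ν, P x) :
    ∃ x, P x ∧ 0 < limsup (fun n => (((L n).filter fun t => x t = true).card : ℝ) / (L n).card)
      atTop := by
  classical
  by_contra! hcon
  have hm : ∀ t, MeasurableSet {x : ι → Bool | x t = true} := fun t =>
    measurableSet_eq_fun (measurable_pi_apply t) measurable_const
  let f : ℕ → (ι → Bool) → ℝ := fun n x =>
    (((L n).filter fun t => x t = true).card : ℝ) / (L n).card
  have hf : ∀ n, f n = fun x => (∑ t ∈ L n, {x : ι → Bool | x t = true}.indicator (1 : (ι → Bool) → ℝ) x) /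
      ((L n).card : ℝ) := by
    intro n
    funext x
    simp [f, Set.indicator_apply]
  have hpos : ∀ n, (0 : ℝ) < (L n).card := fun n => by exact_mod_cast (hL n).card_pos
  have hf0 : ∀ n x, 0 ≤ f n x := fun n x => by positivity
  have hf1 : ∀ n x, f n x ≤ 1 := fun n x =>
    div_le_one_of_le₀ (by exact_mod_cast Finset.card_filter_le _ _) (hpos n).le
  have hmf : ∀ n, Measurable (f n) := by
    intro n
    rw [hf]
    exact (Finset.measurable_fun_sum _ fun t _ => measurable_one.indicator (hm t)).div_const _
  have hlim : ∀ᵐ x ∂ν, Tendsto (fun n => f n x) atTop (𝓝 0) := by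
    filter_upwards [hP] with x hx
    have hb1 : IsBoundedUnder (· ≤ ·) atTop fun n => f n x := isBoundedUnder_of ⟨1, fun n => hf1 n x⟩
    have hb2 : IsBoundedUnder (· ≥ ·) atTop fun n => f n x := isBoundedUnder_of ⟨0, fun n => hf0 n x⟩
    exact tendsto_of_le_liminf_of_limsup_le
      (le_liminf_of_le hb1.isCoboundedUnder_ge (Eventually.of_forall fun n => hf0 n x))
      (hcon x hx) hb1 hb2
  have hint := tendsto_integral_of_dominated_convergence (μ := ν) (F := f) (f := fun _ => (0 : ℝ))
    (fun _ => (1 : ℝ)) (fun n => (hmf n).aestronglyMeasurable) (integrable_const _)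
    (fun n => Eventually.of_forall fun x => by
      rw [Real.norm_of_nonneg (hf0 n x)]; exact hf1 n x) hlim
  rw [integral_zero] at hint
  have hge : ∀ n, η ≤ ∫ x, f n x ∂ν := by
    intro n
    rw [hf]
    simp only [integral_div]
    rw [integral_finsetSum _ fun t _ =>
        (show Integrable (1 : (ι → Bool) → ℝ) ν from integrable_const 1).indicator (hm t),
      le_div_iff₀ (hpos n)]
    calc η * (L n).card = ∑ t ∈ L n, η := by simp [mul_comm]
      _ ≤ _ := Finset.sum_le_sum fun t ht => by
        rw [integral_indicator_one (hm t)]; exact hν n t ht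
  exact absurd (ge_of_tendsto' hint hge) (not_le.2 hη)

/-- The tuples of words of common length `n`. -/
def tuples {d : ℕ} (b : Fin d → ℕ) (n : ℕ) : Finset (∀ i, List (Fin (b i))) :=
  Fintype.piFinset fun _ =>
    (Finset.univ : Finset (List.Vector _ n)).image List.Vector.toList

theorem mem_tuples {d : ℕ} {b : Fin d → ℕ} {n : ℕ} {t : ∀ i, List (Fin (b i))} :
    t ∈ tuples b n ↔ ∀ i, (t i).length = n := by
  simp only [tuples, Fintype.mem_piFinset, Finset.mem_image, Finset.mem_univ, true_and]
  refine forall_congr' fun i => ⟨?_, fun h => ⟨⟨t i, h⟩, rfl⟩⟩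
  rintro ⟨v, hv⟩
  rw [← hv, v.toList_length]

theorem tuples_nonempty {d : ℕ} {b : Fin d → ℕ} (hb : ∀ i, 0 < b i) (n : ℕ) :
    (tuples b n).Nonempty :=
  ⟨fun i => List.replicate n ⟨0, hb i⟩, mem_tuples.2 fun i => by simp⟩

/-- The node of the fan with root `r` given by `σ` lying above the immediate successor `q` of
the root. -/
def fanNode {d : ℕ} {b : Fin d → ℕ} (r : ∀ i, List (Fin (b i)))
    (σ : ∀ i, Fin (b i) → List (Fin (b i))) (q : ∀ i, Fin (b i)) : ∀ i, List (Fin (b i)) :=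
  fun i => r i ++ q i :: σ i (q i)

theorem DHL.exists_fan {d : ℕ} (hDHL : DHL d) {b : Fin d → ℕ} (hb : ∀ i, 2 ≤ b i)
    (x : (∀ i, List (Fin (b i))) → Bool)
    (hx : 0 < limsup (fun n => (((tuples b n).filter fun t => x t = true).card : ℝ) /
      (tuples b n).card) atTop) :
    ∃ m n r σ, (∀ i, (r i).length = m) ∧ (∀ i p, (σ i p).length = n) ∧ x r = true ∧
      ∀ q, x (fanNode r σ q) = true := by
  classical
  have hb0 : ∀ i, 0 < b i := fun i => by have := hb i; omega
  let N : (∀ i, List (Fin (b i))) → Fin d → List ℕ := fun t i => node id (t i)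
  have hN : Function.Injective N := fun s t hst =>
    funext fun i => (isStrongEmb_id (b i)).node_injective (hb0 i) (congrFun hst i)
  let T : Fin d → Set (List ℕ) := fun i => Set.range (node (b := b i) id)
  have hT : IsVecHomogeneous b T := fun i => ⟨hb i, id, by
    have := (isStrongEmb_id (b i)).isStrongSubtreeWith (hb0 i) (isStrongEmb_id (b i))
    rw [← range_node_id]
    exact this⟩
  have hlev : ∀ n, vecLevel T n = N '' (tuples b n : Set (∀ i, List (Fin (b i)))) := by
    intro n
    ext v
    simp only [vecLevel, T, (isStrongEmb_id _).level_eq (hb0 _), Set.mem_image, Finset.mem_coe,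
      mem_tuples, Set.mem_ofPred_eq]
    constructor
    · intro h
      choose t ht hv using h
      exact ⟨t, ht, funext hv⟩
    · rintro ⟨t, ht, rfl⟩ i
      exact ⟨t i, ht i, rfl⟩
  let D : Set (Fin d → List ℕ) := N '' {t | x t = true ∧ ∃ n, t ∈ tuples b n}
  have hDT : D ⊆ levelProd T := by
    rintro _ ⟨t, ⟨-, n, ht⟩, rfl⟩
    refine Set.mem_iUnion.2 ⟨n, ?_⟩
    rw [hlev]
    exact ⟨t, ht, rfl⟩
  have hDn : ∀ n, D ∩ vecLevel T n =
      N '' (((tuples b n).filter fun t => x t = true : Finset _) : Set (∀ i, List (Fin (b i)))) := by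
    intro n
    rw [hlev, ← Set.image_inter hN]
    congr 1
    ext t
    simp only [Set.mem_inter_iff, Set.mem_ofPred_eq, Finset.coe_filter, Finset.mem_coe]
    exact ⟨fun h => ⟨h.2, h.1.1⟩, fun h => ⟨⟨h.2, n, h.1⟩, h.1⟩⟩
  obtain ⟨S, ⟨k, hS⟩, hSD⟩ := hDHL b T hT D hDT (by
    simp only [hDn]
    simp only [hlev, Set.ncard_image_of_injective _ hN, Set.ncard_coe_finset]
    exact hx)
  choose f hf hSf using fun i => (hS i).exists_isStrongEmb (hb0 i) (isStrongEmb_id (b i))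
  have hmem : ∀ n, ∀ t ∈ tuples b n, x (fun i => f i (t i)) = true := by
    intro n t ht
    have h : (fun i => node (f i) (t i)) ∈ levelProd S := by
      refine Set.mem_iUnion.2 ⟨n, fun i => ?_⟩
      rw [hSf, Function.id_comp, (hf i).level_eq (hb0 i)]
      exact ⟨t i, mem_tuples.1 ht i, rfl⟩
    obtain ⟨s, ⟨hs, -⟩, hst⟩ := hSD h
    rwa [← hN (hst : N s = N fun i => f i (t i))]
  choose σ hσ using fun i p => (hf i).2 [] p
  simp only [List.append_assoc, List.singleton_append, List.nil_append] at hσ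
  refine ⟨k 0, k 1 - k 0 - 1, fun i => f i [], σ, fun i => (hf i).1 [], fun i p => ?_,
    hmem 0 (fun _ => []) (mem_tuples.2 fun _ => rfl), fun q => ?_⟩
  · have h1 := (hf i).1 [p]
    rw [← hσ, List.length_append, (hf i).1 []] at h1
    simp only [List.length_cons, List.length_nil, zero_add] at h1
    omega
  · have h := hmem 1 (fun i => [q i]) (mem_tuples.2 fun _ => rfl)
    rw [← h]
    congr 1
    funext i
    exact hσ i (q i)

open MeasureTheory in
/-- A uniform, probabilistic version of the density Halpern–Läuchli property for fans. -/
theorem DHL.exists_uniform_fan {d : ℕ} (hDHL : DHL d) {b : Fin d → ℕ} (hb : ∀ i, 2 ≤ b i) {η : ℝ}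
    (hη : 0 < η) :
    ∃ θ > 0, ∃ M : ℕ, ∀ (Ω : Type) [Fintype Ω] [Nonempty Ω]
      (E : (∀ i, List (Fin (b i))) → Set Ω),
      (∀ n < M, ∀ t ∈ tuples b n, η * Fintype.card Ω ≤ (E t).ncard) →
      ∃ m n r σ, (∀ i, (r i).length = m) ∧ (∀ i p, (σ i p).length = n) ∧ m + 1 + n < M ∧
        θ * Fintype.card Ω ≤ ({ω | ω ∈ E r ∧ ∀ q, ω ∈ E (fanNode r σ q)}.ncard : ℝ) := by
  classical
  by_contra! hcon
  have hb0 : ∀ i, 0 < b i := fun i => by have := hb i; omega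
  choose Ω _ _ E hE hbad using fun k : ℕ => hcon (1 / ((k : ℝ) + 1)) (by positivity) k
  obtain ⟨ν, hν, hlim⟩ := exists_limit_measure Ω E
  have hatTop : Tendsto id (hyperfilter ℕ : Filter ℕ) atTop := by
    exact Nat.hyperfilter_le_atTop
  have hcard : ∀ k, (0 : ℝ) < Fintype.card (Ω k) := fun k => by exact_mod_cast Fintype.card_pos
  have hην : ∀ n, ∀ t ∈ tuples b n, η ≤ ν.real {x | x t = true} := by
    intro n t ht
    have h := hlim {t}
    simp only [Finset.mem_singleton, forall_eq] at h
    refine ge_of_tendsto h ?_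
    filter_upwards [hatTop.eventually (eventually_gt_atTop n)] with k hk
    rw [le_div_iff₀ (hcard k)]
    exact hE k n hk t ht
  have hnull : ∀ (r : ∀ i, List (Fin (b i))) (σ : ∀ i, Fin (b i) → List (Fin (b i))) (m n : ℕ),
      (∀ i, (r i).length = m) → (∀ i p, (σ i p).length = n) →
      ν {x | x r = true ∧ ∀ q, x (fanNode r σ q) = true} = 0 := by
    intro r σ m n hr hσ
    have h := hlim (insert r (Finset.univ.image (fanNode r σ)))
    simp only [Finset.forall_mem_insert, Finset.forall_mem_image, Finset.mem_univ,
      true_imp_iff] at h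
    have h0 : ν.real {x | x r = true ∧ ∀ q, x (fanNode r σ q) = true} ≤ 0 := by
      refine le_of_tendsto_of_tendsto h (tendsto_one_div_add_atTop_nhds_zero_nat.comp hatTop) ?_
      filter_upwards [hatTop.eventually (eventually_gt_atTop (m + 1 + n))] with k hk
      rw [div_le_iff₀ (hcard k)]
      exact (hbad k m n r σ hr hσ hk).le
    exact (measureReal_eq_zero_iff).1 (le_antisymm h0 measureReal_nonneg)
  have hae : ∀ᵐ x ∂ν, ∀ (r : ∀ i, List (Fin (b i))) (σ : ∀ i, Fin (b i) → List (Fin (b i)))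
      (m n : ℕ), (∀ i, (r i).length = m) → (∀ i p, (σ i p).length = n) →
      ¬ (x r = true ∧ ∀ q, x (fanNode r σ q) = true) := by
    simp only [ae_all_iff]
    intro r σ m n hr hσ
    rw [ae_iff]
    simpa using hnull r σ m n hr hσ
  obtain ⟨x, hx, hpos⟩ := exists_limsup_density_pos ν (tuples b) (tuples_nonempty hb0) hη hην hae
  obtain ⟨m, n, r, σ, hr, hσ, h1, h2⟩ := hDHL.exists_fan hb x hpos
  exact hx r σ m n hr hσ ⟨h1, h2⟩

theorem finite_words (c n : ℕ) : {u : List (Fin c) | u.length = n}.Finite :=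
  List.finite_length_eq _ n

theorem ncard_words (c n : ℕ) : {u : List (Fin c) | u.length = n}.ncard = c ^ n := by
  have h := Nat.card_eq_fintype_card (α := List.Vector (Fin c) n)
  rw [card_vector, Fintype.card_fin] at h
  exact h

theorem ncard_extensions {c n N : ℕ} (hnN : n ≤ N) {X : Set (List (Fin c))}
    (hX : ∀ s ∈ X, s.length = n) :
    {v : List (Fin c) | v.length = N ∧ ∃ s ∈ X, s <+: v}.ncard = X.ncard * c ^ (N - n) := by
  rw [← ncard_words c (N - n), ← Set.ncard_prod]
  have : {v : List (Fin c) | v.length = N ∧ ∃ s ∈ X, s <+: v} =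
      (fun x : List (Fin c) × List (Fin c) => x.1 ++ x.2) ''
        (X ×ˢ {u : List (Fin c) | u.length = N - n}) := by
    ext v
    constructor
    · rintro ⟨hv, s, hs, u, rfl⟩
      refine ⟨(s, u), ⟨hs, ?_⟩, rfl⟩
      have := hX s hs
      simp only [List.length_append] at hv
      change u.length = N - n
      omega
    · rintro ⟨⟨s, u⟩, ⟨hs, hu⟩, rfl⟩
      have h1 := hX s hs
      change u.length = N - n at hu
      exact ⟨by simp only [List.length_append]; omega, s, hs, List.prefix_append _ _⟩
  rw [this]
  refine Set.InjOn.ncard_image ?_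
  rintro ⟨s, u⟩ ⟨hs, -⟩ ⟨s', u'⟩ ⟨hs', -⟩ heq
  obtain ⟨h1, h2⟩ := List.append_inj heq ((hX s hs).trans (hX s' hs').symm)
  exact Prod.ext h1 h2

theorem ncard_vector_extensions {c n N : ℕ} (hnN : n ≤ N) {X : Set (List (Fin c))}
    (hX : ∀ s ∈ X, s.length = n) :
    {v : List.Vector (Fin c) N | ∃ s ∈ X, s <+: v.toList}.ncard = X.ncard * c ^ (N - n) := by
  rw [← ncard_extensions hnN hX, ← Set.ncard_image_of_injective _ List.Vector.toList_injective]
  congr 1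
  ext v
  constructor
  · rintro ⟨⟨v, hv⟩, h, rfl⟩
    exact ⟨hv, h⟩
  · rintro ⟨hv, h⟩
    exact ⟨⟨v, hv⟩, h, rfl⟩

section Fans

variable {d c : ℕ} {b : Fin d → ℕ}

/-- The words extending `s` that are selected by every node of the fan. -/
def fanSet (A : (∀ i, List (Fin (b i))) → Set (List (Fin c))) (r : ∀ i, List (Fin (b i)))
    (σ : ∀ i, Fin (b i) → List (Fin (b i))) (s : List (Fin c)) : Set (List (Fin c)) :=
  {v | s <+: v ∧ ∀ q, v ∈ A (fanNode r σ q)}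

/-- The words selected by the fan at `r` (at level `m`) given by `σ` have density at least `θ`
relative to the word `s` of length `h m + 1`. -/
def FanGood (A : (∀ i, List (Fin (b i))) → Set (List (Fin c))) (h : ℕ → ℕ) (θ : ℝ) (m n : ℕ)
    (r : ∀ i, List (Fin (b i))) (σ : ∀ i, Fin (b i) → List (Fin (b i))) (s : List (Fin c)) :
    Prop :=
  θ * (c : ℝ) ^ h (m + 1 + n) ≤ (fanSet A r σ s).ncard * (c : ℝ) ^ (h m + 1)

/-- The immediate successors of the words selected by `r` relative to which no fan at `r` has
density at least `θ`. -/
def badSet (A : (∀ i, List (Fin (b i))) → Set (List (Fin c))) (h : ℕ → ℕ) (θ : ℝ) (m : ℕ)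
    (r : ∀ i, List (Fin (b i))) : Set (List (Fin c)) :=
  {s | (∃ w ∈ A r, ∃ p, s = w ++ [p]) ∧
    ∀ n σ, (∀ i p, (σ i p).length = n) → ¬ FanGood A h θ m n r σ s}

/-- The selection `A` takes level `n` of the tuples of words to level `h n`. -/
def IsLevelMap (A : (∀ i, List (Fin (b i))) → Set (List (Fin c))) (h : ℕ → ℕ) : Prop :=
  StrictMono h ∧ ∀ n, ∀ t ∈ tuples b n, ∀ v ∈ A t, v.length = h n

theorem IsLevelMap.comp {A : (∀ i, List (Fin (b i))) → Set (List (Fin c))} {h k : ℕ → ℕ}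
    (hA : IsLevelMap A h) (hk : StrictMono k) {g : ∀ i, List (Fin (b i)) → List (Fin (b i))}
    (hg : ∀ i, IsStrongEmb k (g i)) :
    IsLevelMap (fun t => A fun i => g i (t i)) (h ∘ k) :=
  ⟨hA.1.comp hk, fun n t ht v hv => hA.2 (k n) (fun i => g i (t i))
    (mem_tuples.2 fun i => by rw [(hg i).1, mem_tuples.1 ht i]) v hv⟩

theorem IsLevelMap.length_of_mem_badSet {A : (∀ i, List (Fin (b i))) → Set (List (Fin c))}
    {h : ℕ → ℕ} (hA : IsLevelMap A h) {θ : ℝ} {m : ℕ} {r : ∀ i, List (Fin (b i))}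
    (hr : r ∈ tuples b m) {s : List (Fin c)} (hs : s ∈ badSet A h θ m r) :
    s.length = h m + 1 := by
  obtain ⟨⟨w, hw, p, rfl⟩, -⟩ := hs
  simp [hA.2 m r hr w hw]

theorem IsLevelMap.finite_badSet {A : (∀ i, List (Fin (b i))) → Set (List (Fin c))}
    {h : ℕ → ℕ} (hA : IsLevelMap A h) (θ : ℝ) {m : ℕ} {r : ∀ i, List (Fin (b i))}
    (hr : r ∈ tuples b m) : (badSet A h θ m r).Finite :=
  (finite_words c (h m + 1)).subset fun _ hs => hA.length_of_mem_badSet hr hs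

theorem fanNode_mem_tuples {m n : ℕ} {r : ∀ i, List (Fin (b i))} (hr : ∀ i, (r i).length = m)
    {σ : ∀ i, Fin (b i) → List (Fin (b i))} (hσ : ∀ i p, (σ i p).length = n)
    (q : ∀ i, Fin (b i)) : fanNode r σ q ∈ tuples b (m + 1 + n) :=
  mem_tuples.2 fun i => by simp [fanNode, hr, hσ]; omega

theorem badSet_subset_comp {A : (∀ i, List (Fin (b i))) → Set (List (Fin c))} {h k : ℕ → ℕ}
    {f : ∀ i, List (Fin (b i)) → List (Fin (b i))} (hk : StrictMono k)
    (hf : ∀ i, IsStrongEmb k (f i)) {m : ℕ}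
    (hkm : k m = m) (hfm : ∀ i (u : List (Fin (b i))), u.length ≤ m + 1 → f i u = u)
    {r : ∀ i, List (Fin (b i))} (hr : r ∈ tuples b m) (θ : ℝ) :
    badSet A h θ m r ⊆ badSet (fun t => A fun i => f i (t i)) (h ∘ k) θ m r := by
  have hrm := mem_tuples.1 hr
  rintro s ⟨⟨w, hw, p, rfl⟩, hs⟩
  have hfr : (fun i => f i (r i)) = r := funext fun i => hfm i _ (by rw [hrm]; omega)
  refine ⟨⟨w, ?_, p, rfl⟩, fun n σ hσ hgood => ?_⟩
  · change w ∈ A fun i => f i (r i)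
    rwa [hfr]
  have hpre : ∀ i p, r i ++ [p] <+: f i (r i ++ p :: σ i p) := by
    intro i p
    rw [← hfm i (r i ++ [p]) (by simp [hrm])]
    exact (hf i).prefix_mono ⟨σ i p, by simp⟩
  choose τ hτ using hpre
  have hmk : m + 1 ≤ k (m + 1 + n) := by
    have := hk (show m < m + 1 + n by omega)
    omega
  refine hs (k (m + 1 + n) - (m + 1)) τ (fun i p => ?_) ?_
  · have h1 := congrArg List.length (hτ i p)
    rw [(hf i).1] at h1
    simp only [List.length_append, List.length_cons, List.length_nil, hrm, hσ] at h1
    rw [show m + (n + 1) = m + 1 + n by omega] at h1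
    omega
  · have hset : fanSet A r τ (w ++ [p]) =
        fanSet (fun t => A fun i => f i (t i)) r σ (w ++ [p]) := by
      have : ∀ q, fanNode r τ q = fun i => f i (fanNode r σ q i) := fun q => funext fun i => by
        simp only [fanNode, ← hτ, List.append_assoc, List.singleton_append]
      simp only [fanSet, this]
    unfold FanGood at hgood ⊢
    rw [hset, show m + 1 + (k (m + 1 + n) - (m + 1)) = k (m + 1 + n) by omega]
    simpa [hkm] using hgood

/-- After passing to a vector strong subtree, whether a fan at a node of level `j` is good
relative to a given word does not depend on the fan. -/
theorem exists_strongEmb_fan_dichotomy (hd : 0 < d) (hb : ∀ i, 0 < b i)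
    (A : (∀ i, List (Fin (b i))) → Set (List (Fin c))) (h : ℕ → ℕ) (θ : ℝ) (j : ℕ) :
    ∃ (k : ℕ → ℕ) (f : ∀ i, List (Fin (b i)) → List (Fin (b i))), StrictMono k ∧
      (∀ i, IsStrongEmb k (f i)) ∧ (∀ m ≤ j, k m = m) ∧
      (∀ i (u : List (Fin (b i))), u.length ≤ j → f i u = u) ∧
      ∀ r ∈ tuples b j, ∀ s : List (Fin c), s.length = h j + 1 →
        (∀ n σ, (∀ i p, (σ i p).length = n) →
          FanGood (fun t => A fun i => f i (t i)) (h ∘ k) θ j n r σ s) ∨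
        (∀ n σ, (∀ i p, (σ i p).length = n) →
          ¬ FanGood (fun t => A fun i => f i (t i)) (h ∘ k) θ j n r σ s) := by
  let i₀ : Fin d := ⟨0, hd⟩
  let N : (∀ i, List.Vector (Fin (b i)) (j + 1) → List (Fin (b i))) → ℕ := fun x =>
    (x i₀ (List.Vector.replicate _ ⟨0, hb i₀⟩)).length
  let χ : (∀ i, List.Vector (Fin (b i)) (j + 1) → List (Fin (b i))) →
      Set ((∀ i, List.Vector (Fin (b i)) j) × List.Vector (Fin c) (h j + 1)) := fun x =>
    {y | θ * (c : ℝ) ^ h (N x) ≤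
      ({v | y.2.1 <+: v ∧ ∀ q : ∀ i, Fin (b i), v ∈ A fun i =>
        x i ⟨(y.1 i).1 ++ [q i], by rw [List.length_append, (y.1 i).2]; rfl⟩}.ncard : ℝ)
        * (c : ℝ) ^ (h j + 1)}
  obtain ⟨k, f, κ, hf, hfJ, hκ⟩ := exists_strongEmb_homogeneous b (j + 1) χ
  have hkm : ∀ m ≤ j, k m = m := by
    intro m hm
    have h1 := (hf i₀).1 (List.replicate m ⟨0, hb i₀⟩)
    rw [hfJ i₀ _ (by simp; omega)] at h1
    simpa using h1.symm
  refine ⟨k, f, (hf i₀).strictMono (hb i₀), hf, hkm, fun i u hu => hfJ i u (by omega), ?_⟩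
  intro r hr s hs
  have hr := mem_tuples.1 hr
  have key : ∀ n σ, (∀ i p, (σ i p).length = n) →
      (FanGood (fun t => A fun i => f i (t i)) (h ∘ k) θ j n r σ s ↔
        ((fun i => ⟨r i, hr i⟩, ⟨s, hs⟩) :
          (∀ i, List.Vector (Fin (b i)) j) × List.Vector (Fin c) (h j + 1)) ∈ κ) := by
    intro n σ hσ
    have hne : ∀ i (q : List.Vector (Fin (b i)) (j + 1)), q.1 ≠ [] := fun i q h0 => by
      have := q.2
      simp [h0] at this
    rw [← hκ n (fun i q => σ i (q.1.getLast (hne i q))) fun i q => hσ i _]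
    have hlen : ∀ v : List.Vector (Fin (b i₀)) (j + 1), v.1.length = j + 1 := fun v => v.2
    simp only [χ, N, Set.mem_ofPred_eq, FanGood, fanSet, fanNode, (hf i₀).1, List.length_append,
      hσ, hlen, List.getLast_append_singleton, List.append_assoc, List.singleton_append,
      Function.comp_apply, hkm j le_rfl]
  by_cases hmem : ((fun i => ⟨r i, hr i⟩, ⟨s, hs⟩) :
      (∀ i, List.Vector (Fin (b i)) j) × List.Vector (Fin c) (h j + 1)) ∈ κ
  · exact Or.inl fun n σ hσ => (key n σ hσ).2 hmem
  · exact Or.inr fun n σ hσ hg => hmem ((key n σ hσ).1 hg)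

/-- The words all of whose immediate successors are good for all fans at `r`. -/
def goodSet (A : (∀ i, List (Fin (b i))) → Set (List (Fin c))) (h : ℕ → ℕ) (θ : ℝ) (m : ℕ)
    (r : ∀ i, List (Fin (b i))) : Set (List (Fin c)) :=
  {w ∈ A r | ∀ p n σ, (∀ i p, (σ i p).length = n) → FanGood A h θ m n r σ (w ++ [p])}

theorem IsLevelMap.ncard_le_goodSet_add_badSet
    {A : (∀ i, List (Fin (b i))) → Set (List (Fin c))} {h : ℕ → ℕ} (hA : IsLevelMap A h) {θ : ℝ}
    {m : ℕ} {r : ∀ i, List (Fin (b i))} (hr : r ∈ tuples b m)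
    (hdich : ∀ s : List (Fin c), s.length = h m + 1 →
      (∀ n σ, (∀ i p, (σ i p).length = n) → FanGood A h θ m n r σ s) ∨
      (∀ n σ, (∀ i p, (σ i p).length = n) → ¬ FanGood A h θ m n r σ s)) :
    (A r).ncard ≤ (goodSet A h θ m r).ncard + (badSet A h θ m r).ncard := by
  have hfin : (A r).Finite := (finite_words c (h m)).subset fun v hv => hA.2 m r hr v hv
  have hsub : A r ⊆ goodSet A h θ m r ∪ List.dropLast '' badSet A h θ m r := by
    intro w hw
    by_cases hg : w ∈ goodSet A h θ m r
    · exact Or.inl hg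
    · refine Or.inr ?_
      have : ∃ p, ¬ ∀ n σ, (∀ i p, (σ i p).length = n) → FanGood A h θ m n r σ (w ++ [p]) := by
        by_contra! hall
        exact hg ⟨hw, hall⟩
      obtain ⟨p, hp⟩ := this
      refine ⟨w ++ [p], ⟨⟨w, hw, p, rfl⟩, ?_⟩, by simp⟩
      exact (hdich (w ++ [p]) (by simp [hA.2 m r hr w hw])).resolve_left hp
  have hgfin : (goodSet A h θ m r).Finite := hfin.subset fun w hw => hw.1
  have hbfin := hA.finite_badSet θ hr
  calc (A r).ncard ≤ _ := Set.ncard_le_ncard hsub (hgfin.union (hbfin.image _))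
    _ ≤ _ := Set.ncard_union_le _ _
    _ ≤ _ := Nat.add_le_add_left (Set.ncard_image_le hbfin) _

/-- If the set of bad words is large at all nodes of the first levels then the property provided
by `DHL.exists_uniform_fan` fails. -/
theorem IsLevelMap.exists_ncard_badSet_lt (hd : 0 < d) (hDHL : DHL d) (hb : ∀ i, 2 ≤ b i) (hc : 0 < c) {δ : ℝ}
    (hδ : 0 < δ) : ∃ θ : ℝ, 0 < θ ∧ θ ≤ 1 ∧ ∃ M : ℕ,
      ∀ (A : (∀ i, List (Fin (b i))) → Set (List (Fin c))) (h : ℕ → ℕ), IsLevelMap A h →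
        ∃ m < M, ∃ r ∈ tuples b m, ((badSet A h θ m r).ncard : ℝ) < δ * (c : ℝ) ^ h m := by
  have hc' : (0 : ℝ) < c := by exact_mod_cast hc
  obtain ⟨θ', hθ', M, hM⟩ := hDHL.exists_uniform_fan hb (div_pos hδ hc')
  refine ⟨min (θ' / 2) 1, lt_min (by positivity) one_pos, min_le_right _ _, M, ?_⟩
  intro A h hA
  set θ := min (θ' / 2) 1
  by_contra! hcon
  let N := h M + 1
  have hhN : ∀ m < M, h m + 1 ≤ N := fun m hm => by
    have := hA.1 hm
    simp only [N]; omega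
  have : NeZero c := ⟨hc.ne'⟩
  have : Nonempty (List.Vector (Fin c) N) := ⟨List.Vector.replicate N 0⟩
  let E : (∀ i, List (Fin (b i))) → Set (List.Vector (Fin c) N) := fun t =>
    {v | ∃ m, t ∈ tuples b m ∧ ∃ s ∈ badSet A h θ m t, s <+: v.toList}
  have hcard : (Fintype.card (List.Vector (Fin c) N) : ℝ) = (c : ℝ) ^ N := by
    rw [card_vector, Fintype.card_fin]; push_cast; rfl
  have hEge : ∀ m < M, ∀ t ∈ tuples b m,
      δ / c * Fintype.card (List.Vector (Fin c) N) ≤ (E t).ncard := by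
    intro m hm t ht
    have hsub : {v : List.Vector (Fin c) N | ∃ s ∈ badSet A h θ m t, s <+: v.toList} ⊆ E t :=
      fun v hv => ⟨m, ht, hv⟩
    have h1 := Set.ncard_le_ncard hsub (Set.toFinite _)
    rw [ncard_vector_extensions (hhN m hm) fun s hs => hA.length_of_mem_badSet ht hs] at h1
    rw [hcard]
    have h2 : (((badSet A h θ m t).ncard * c ^ (N - (h m + 1)) : ℕ) : ℝ) ≤ (E t).ncard := by
      exact_mod_cast h1
    refine le_trans ?_ h2
    push_cast
    have h3 : (c : ℝ) ^ N = c ^ h m * c * c ^ (N - (h m + 1)) := by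
      rw [← pow_succ, ← pow_add]
      congr 1
      have := hhN m hm
      omega
    rw [h3]
    calc δ / c * ((c : ℝ) ^ h m * c * c ^ (N - (h m + 1)))
        = δ * c ^ h m * c ^ (N - (h m + 1)) := by field_simp
      _ ≤ _ := mul_le_mul_of_nonneg_right (hcon m hm t ht) (by positivity)
  obtain ⟨m, n, r, σ, hr, hσ, hmn, hfan⟩ := hM (List.Vector (Fin c) N) E hEge
  have hrt : r ∈ tuples b m := mem_tuples.2 hr
  have hbfin := hA.finite_badSet θ hrt
  let q₀ : ∀ i, Fin (b i) := fun i => ⟨0, by have := hb i; omega⟩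
  have hfanlen : ∀ s, ∀ v ∈ fanSet A r σ s, v.length = h (m + 1 + n) := fun s v hv =>
    hA.2 _ _ (fanNode_mem_tuples hr hσ q₀) v (hv.2 q₀)
  have htuples : ∀ {t : ∀ i, List (Fin (b i))} {m m' : ℕ}, t ∈ tuples b m → t ∈ tuples b m' →
      m = m' := fun {t m m'} h1 h2 =>
    (mem_tuples.1 h1 ⟨0, hd⟩).symm.trans (mem_tuples.1 h2 ⟨0, hd⟩)
  have hHN := hhN _ hmn
  have hsub : {ω : List.Vector (Fin c) N | ω ∈ E r ∧ ∀ q, ω ∈ E (fanNode r σ q)} ⊆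
      ⋃ s ∈ hbfin.toFinset, {ω | ∃ v ∈ fanSet A r σ s, v <+: ω.toList} := by
    rintro ω ⟨⟨m', hm', s, hs, hsω⟩, hq⟩
    obtain rfl := htuples hrt hm'
    have hslen := hA.length_of_mem_badSet hrt hs
    refine Set.mem_biUnion (hbfin.mem_toFinset.2 hs)
      ⟨ω.toList.take (h (m + 1 + n)), ⟨?_, fun q => ?_⟩, List.take_prefix _ _⟩
    · refine List.prefix_of_prefix_length_le hsω (List.take_prefix _ _) ?_
      have := hA.1 (show m < m + 1 + n by omega)
      simp only [hslen, List.length_take, List.Vector.toList_length]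
      omega
    · obtain ⟨m'', hm'', s', ⟨⟨w, hw, p, rfl⟩, -⟩, hs'ω⟩ := hq q
      have hwlen := hA.2 _ _ (fanNode_mem_tuples hr hσ q) w hw
      rw [← hwlen, ← List.prefix_iff_eq_take.1 ((List.prefix_append w [p]).trans hs'ω)]
      exact hw
  have hcount : ({ω : List.Vector (Fin c) N | ω ∈ E r ∧ ∀ q, ω ∈ E (fanNode r σ q)}.ncard) ≤
      ∑ s ∈ hbfin.toFinset, (fanSet A r σ s).ncard * c ^ (N - h (m + 1 + n)) := by
    refine (Set.ncard_le_ncard hsub (Set.toFinite _)).trans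
      ((Finset.set_ncard_biUnion_le _ _).trans (Finset.sum_le_sum fun s _ => ?_))
    rw [ncard_vector_extensions (by omega) (hfanlen s)]
  have hsum : (∑ s ∈ hbfin.toFinset,
      ((fanSet A r σ s).ncard : ℝ) * (c : ℝ) ^ (N - h (m + 1 + n))) * (c : ℝ) ^ (h m + 1) ≤
      θ * c ^ N * (c : ℝ) ^ (h m + 1) := by
    have hNpow : (c : ℝ) ^ N = c ^ h (m + 1 + n) * c ^ (N - h (m + 1 + n)) := by
      rw [← pow_add]; congr 1; omega
    have hbad : (hbfin.toFinset.card : ℝ) ≤ (c : ℝ) ^ (h m + 1) := by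
      rw [← Set.ncard_eq_toFinset_card _ hbfin]
      have hsub' : badSet A h θ m r ⊆ {s | s.length = h m + 1} :=
        fun s hs => hA.length_of_mem_badSet hrt hs
      have := Set.ncard_le_ncard hsub' (finite_words _ _)
      rw [ncard_words] at this
      exact_mod_cast this
    have hθ0 : 0 ≤ θ := (lt_min (by positivity) one_pos : 0 < θ).le
    rw [Finset.sum_mul]
    calc _ ≤ ∑ s ∈ hbfin.toFinset, θ * (c : ℝ) ^ N := Finset.sum_le_sum fun s hs => by
          have hnot := ((hbfin.mem_toFinset.1 hs).2 n σ hσ)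
          rw [FanGood, not_le] at hnot
          rw [hNpow, mul_right_comm, ← mul_assoc]
          exact mul_le_mul_of_nonneg_right hnot.le (by positivity)
      _ = hbfin.toFinset.card * (θ * (c : ℝ) ^ N) := by simp
      _ ≤ _ := by
        rw [mul_comm]
        exact mul_le_mul_of_nonneg_left hbad (by positivity)
  have hsum' := le_of_mul_le_mul_right hsum (by positivity)
  have hcount' : (({ω : List.Vector (Fin c) N | ω ∈ E r ∧
      ∀ q, ω ∈ E (fanNode r σ q)}.ncard : ℕ) : ℝ) ≤ ∑ s ∈ hbfin.toFinset,
      ((fanSet A r σ s).ncard : ℝ) * (c : ℝ) ^ (N - h (m + 1 + n)) := by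
    exact_mod_cast hcount
  rw [hcard] at hfan
  have hlt : θ < θ' := (min_le_left _ _).trans_lt (by linarith)
  exact absurd (hfan.trans (hcount'.trans hsum'))
    (not_le.2 (mul_lt_mul_of_pos_right hlt (by positivity)))

/-- Either some vector strong subtree has a node at which the good words are almost all of the
selected words, or some vector strong subtree has many bad words at all nodes of the first `j`
levels. -/
theorem IsLevelMap.exists_goodSet_or_forall_badSet (hd : 0 < d) (hb : ∀ i, 0 < b i)
    {A : (∀ i, List (Fin (b i))) → Set (List (Fin c))} {h : ℕ → ℕ} (hA : IsLevelMap A h)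
    (θ δ : ℝ) (j : ℕ) :
    ∃ (k : ℕ → ℕ) (g : ∀ i, List (Fin (b i)) → List (Fin (b i))),
      StrictMono k ∧ (∀ i, IsStrongEmb k (g i)) ∧
      ((∃ m, ∃ r ∈ tuples b m, ((A fun i => g i (r i)).ncard : ℝ) - δ * (c : ℝ) ^ h (k m) ≤
          (goodSet (fun t => A fun i => g i (t i)) (h ∘ k) θ m r).ncard) ∨
        ∀ m < j, ∀ r ∈ tuples b m, δ * (c : ℝ) ^ h (k m) ≤
          (badSet (fun t => A fun i => g i (t i)) (h ∘ k) θ m r).ncard) := by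
  induction j with
  | zero => exact ⟨id, fun _ => id, strictMono_id, fun i => isStrongEmb_id _, Or.inr (by simp)⟩
  | succ j ih =>
    obtain ⟨k, g, hk, hg, hgood | hbad⟩ := ih
    · exact ⟨k, g, hk, hg, Or.inl hgood⟩
    have hAg := hA.comp hk hg
    obtain ⟨k', f, hk', hf, hkm, hfm, hdich⟩ := exists_strongEmb_fan_dichotomy hd hb
      (fun t => A fun i => g i (t i)) (h ∘ k) θ j
    have hAgf := hAg.comp hk' hf
    refine ⟨k ∘ k', fun i => g i ∘ f i, hk.comp hk', fun i => (hg i).comp (hf i), ?_⟩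
    by_cases hall : ∀ r ∈ tuples b j, δ * (c : ℝ) ^ h (k (k' j)) ≤
        (badSet (fun t => A fun i => g i (f i (t i))) ((h ∘ k) ∘ k') θ j r).ncard
    · refine Or.inr fun m hm r hr => ?_
      rcases Nat.lt_succ_iff_lt_or_eq.1 hm with hm | rfl
      · have hle := Set.ncard_le_ncard (badSet_subset_comp (A := fun t => A fun i => g i (t i))
          (h := h ∘ k) hk' hf (hkm m hm.le) (fun i u hu => hfm i u (by omega)) hr θ)
          (hAgf.finite_badSet θ hr)
        rw [Function.comp_apply, hkm m hm.le]
        exact (hbad m hm r hr).trans (by exact_mod_cast hle)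
      · exact hall r hr
    · push Not at hall
      obtain ⟨r, hr, hlt⟩ := hall
      refine Or.inl ⟨j, r, hr, ?_⟩
      have hle := hAgf.ncard_le_goodSet_add_badSet (θ := θ) hr fun s hs =>
        hdich r hr s (by rw [hs, Function.comp_apply, hkm j le_rfl])
      have hle' : ((A fun i => g i (f i (r i))).ncard : ℝ) ≤
          (goodSet (fun t => A fun i => g i (f i (t i))) ((h ∘ k) ∘ k') θ j r).ncard +
          (badSet (fun t => A fun i => g i (f i (t i))) ((h ∘ k) ∘ k') θ j r).ncard := by
        exact_mod_cast hle
      exact (show ((A fun i => g i (f i (r i))).ncard : ℝ) - δ * (c : ℝ) ^ h (k (k' j)) ≤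
        (goodSet (fun t => A fun i => g i (f i (t i))) ((h ∘ k) ∘ k') θ j r).ncard by linarith)

theorem isStrongEmb_append {b m : ℕ} {r : List (Fin b)} (hr : r.length = m) :
    IsStrongEmb (m + ·) (r ++ ·) :=
  ⟨fun u => by simp [hr], fun u p => by simp⟩

theorem fanSet_append (A : (∀ i, List (Fin (b i))) → Set (List (Fin c)))
    (r : ∀ i, List (Fin (b i))) (σ : ∀ i, Fin (b i) → List (Fin (b i))) (s : List (Fin c)) :
    fanSet (fun t => A fun i => r i ++ t i) (fun _ => []) σ s = fanSet A r σ s := rfl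

/-- Some vector strong subtree has the property that the good words at its root are almost all
of the selected words. -/
theorem IsLevelMap.exists_goodSet (hd : 0 < d) (hDHL : DHL d) (hb : ∀ i, 2 ≤ b i) (hc : 0 < c)
    {A : (∀ i, List (Fin (b i))) → Set (List (Fin c))} {h : ℕ → ℕ} (hA : IsLevelMap A h) {δ : ℝ}
    (hδ : 0 < δ) :
    ∃ θ : ℝ, 0 < θ ∧ θ ≤ 1 ∧
    ∃ (k : ℕ → ℕ) (g : ∀ i, List (Fin (b i)) → List (Fin (b i))),
      StrictMono k ∧ (∀ i, IsStrongEmb k (g i)) ∧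
      ((A fun i => g i []).ncard : ℝ) - δ * (c : ℝ) ^ h (k 0) ≤
        (goodSet (fun t => A fun i => g i (t i)) (h ∘ k) θ 0 fun _ => []).ncard := by
  have hb0 : ∀ i, 0 < b i := fun i => by have := hb i; omega
  obtain ⟨θ, hθ0, hθ1, M, hM⟩ := IsLevelMap.exists_ncard_badSet_lt (b := b) hd hDHL hb hc hδ
  obtain ⟨k, g, hk, hg, ⟨m, r, hr, hgood⟩ | hbad⟩ :=
    hA.exists_goodSet_or_forall_badSet hd hb0 θ δ M
  · refine ⟨θ, hθ0, hθ1, k ∘ (m + ·), fun i => g i ∘ (r i ++ ·),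
      hk.comp fun _ _ hab => Nat.add_lt_add_left hab m,
      fun i => (hg i).comp (isStrongEmb_append (mem_tuples.1 hr i)), ?_⟩
    simp only [Function.comp_apply, List.append_nil, add_zero]
    refine hgood.trans (le_of_eq ?_)
    congr 2
    ext w
    simp only [goodSet, FanGood, Set.mem_ofPred_eq, Function.comp_apply, List.append_nil, add_zero,
      fanSet_append (fun t => A fun i => g i (t i)), zero_add, add_assoc]
  · obtain ⟨m, hm, r, hr, hlt⟩ := hM _ _ (hA.comp hk hg)
    exact absurd (hbad m hm r hr) (not_le.2 hlt)

end Fans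

theorem level_of_downward_closed {T S : Set (List ℕ)} (hST : S ⊆ T)
    (hS : ∀ s ∈ T, ∀ t ∈ S, s <+: t → s ∈ S) (n : ℕ) : level S n = level T n ∩ S := by
  have key : ∀ t ∈ S, {s ∈ S | s <+: t ∧ s ≠ t} = {s ∈ T | s <+: t ∧ s ≠ t} := fun t ht => by
    ext s
    exact ⟨fun h => ⟨hST h.1, h.2⟩, fun h => ⟨hS s h.1 t ht h.2.1, h.2⟩⟩
  ext t
  constructor
  · rintro ⟨ht, hn⟩
    rw [key t ht] at hn
    exact ⟨⟨hST ht, hn⟩, ht⟩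
  · rintro ⟨⟨-, hn⟩, ht⟩
    rw [← key t ht] at hn
    exact ⟨ht, hn⟩

theorem IsStrongEmb.level_fan {b : ℕ} (hb : 0 < b) {h : ℕ → ℕ} {g : List (Fin b) → List (Fin b)}
    (hg : IsStrongEmb h g) {n : ℕ} (hn : n ≤ 1) :
    level (level (Set.range (node g)) 0 ∪ level (Set.range (node g)) 1) n =
      node g '' {u | u.length = n} := by
  have hfan : level (Set.range (node g)) 0 ∪ level (Set.range (node g)) 1 =
      node g '' {u | u.length ≤ 1} := by
    rw [hg.level_eq hb, hg.level_eq hb, ← Set.image_union]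
    congr 1
    ext u
    simp only [Set.mem_union, Set.mem_ofPred_eq]
    omega
  rw [hfan, level_of_downward_closed (T := Set.range (node g)), hg.level_eq hb]
  · rw [← Set.image_inter (hg.node_injective hb)]
    congr 1
    ext u
    simp only [Set.mem_inter_iff, Set.mem_ofPred_eq]
    omega
  · exact Set.image_subset_range _ _
  · rintro _ ⟨u, rfl⟩ _ ⟨v, hv, rfl⟩ huv
    exact ⟨u, ((hg.node_prefix_iff hb).1 huv).length_le.trans hv, rfl⟩

theorem IsStrongEmb.node_mem_level_iff {b : ℕ} (hb : 0 < b) {h : ℕ → ℕ}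
    {g : List (Fin b) → List (Fin b)} (hg : IsStrongEmb h g) {u : List (Fin b)} {n : ℕ} :
    node g u ∈ level (Set.range (node g)) n ↔ u.length = n := by
  rw [hg.level_eq hb, (hg.node_injective hb).mem_set_image]
  rfl

theorem IsStrongEmb.ncard_level {b : ℕ} (hb : 0 < b) {h : ℕ → ℕ}
    {g : List (Fin b) → List (Fin b)} (hg : IsStrongEmb h g) (n : ℕ) :
    (level (Set.range (node g)) n).ncard = b ^ n := by
  rw [hg.level_eq hb, Set.ncard_image_of_injective _ (hg.node_injective hb), ncard_words]

theorem IsStrongEmb.ncard_level_inter_suc {b : ℕ} (hb : 0 < b) {h : ℕ → ℕ}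
    {g : List (Fin b) → List (Fin b)} (hg : IsStrongEmb h g) {s : List (Fin b)} {n : ℕ}
    (hs : s.length ≤ n) :
    (level (Set.range (node g)) n ∩ suc (Set.range (node g)) (node g s)).ncard =
      b ^ (n - s.length) := by
  have : level (Set.range (node g)) n ∩ suc (Set.range (node g)) (node g s) =
      node g '' {v | v.length = n ∧ ∃ t ∈ ({s} : Set (List (Fin b))), t <+: v} := by
    rw [hg.level_eq hb]
    ext x
    constructor
    · rintro ⟨⟨v, hv, rfl⟩, -, hsv⟩
      exact ⟨v, ⟨hv, s, rfl, (hg.node_prefix_iff hb).1 hsv⟩, rfl⟩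
    · rintro ⟨v, ⟨hv, t, rfl, htv⟩, rfl⟩
      exact ⟨⟨v, hv, rfl⟩, ⟨v, rfl⟩, (hg.node_prefix_iff hb).2 htv⟩
  rw [this, Set.ncard_image_of_injective _ (hg.node_injective hb),
    ncard_extensions hs (by simp), Set.ncard_singleton, one_mul]

/-- A vector fan of a vector strong subtree with the same root consists of the root and of one
node above each of its immediate successors. -/
theorem IsVecFan.exists_fanNode {d : ℕ} {b : Fin d → ℕ} (hb : ∀ i, 0 < b i)
    {h : Fin d → ℕ → ℕ} {g : ∀ i, List (Fin (b i)) → List (Fin (b i))}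
    (hg : ∀ i, IsStrongEmb (h i) (g i)) {F : Fin d → Set (List ℕ)}
    (hF : IsVecFan (fun i => Set.range (node (g i))) F)
    (hroot : IsRoot F fun i => node (g i) []) :
    ∃ (n : ℕ) (σ : ∀ i, Fin (b i) → List (Fin (b i))), (∀ i p, (σ i p).length = n) ∧
      vecLevel F 1 = Set.range fun q i => node (g i) (fanNode (fun _ => []) σ q i) := by
  obtain ⟨R, ⟨k, hR⟩, hFR⟩ := hF
  choose f hf hRf using fun i => (hR i).exists_isStrongEmb (hb i) (hg i)
  have hlev : ∀ i, ∀ n ≤ 1, level (F i) n = node (g i ∘ f i) '' {u | u.length = n} := by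
    intro i n hn
    rw [hFR, hRf, ((hg i).comp (hf i)).level_fan (hb i) hn]
  have hf0 : ∀ i, f i [] = [] := by
    intro i
    have h1 : node (g i) (f i []) ∈ level (F i) 0 := by
      rw [hlev i 0 zero_le_one]
      exact ⟨[], rfl, rfl⟩
    rw [hroot i] at h1
    exact (hg i).node_injective (hb i) h1
  choose σ hσ using fun i p => (hf i).2 [] p
  simp only [hf0, List.nil_append, List.singleton_append] at hσ
  refine ⟨k 1 - 1, σ, fun i p => ?_, ?_⟩
  · have h1 := (hf i).1 [p]
    rw [← hσ] at h1
    simp only [List.length_cons, List.length_nil, zero_add] at h1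
    omega
  · ext v
    simp only [vecLevel, Set.mem_ofPred_eq, Set.mem_range]
    constructor
    · intro hv
      have : ∀ i, ∃ q, node (g i) (q :: σ i q) = v i := by
        intro i
        have hvi := hv i
        rw [hlev i 1 le_rfl] at hvi
        obtain ⟨u, hu, huv⟩ := hvi
        obtain ⟨q, rfl⟩ := List.length_eq_one_iff.1 hu
        exact ⟨q, by rw [hσ]; exact huv⟩
      choose q hq using this
      exact ⟨q, funext hq⟩
    · rintro ⟨q, rfl⟩ i
      rw [hlev i 1 le_rfl]
      exact ⟨[q i], rfl, congrArg (node (g i)) (hσ i (q i)).symm⟩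

/-- Theorem 4.11: almost all nodes of `D(r0)` are strongly correlated. -/
theorem strongly_correlated_almost_all (d : ℕ) (hd : 1 ≤ d) (hDHL : DHL d)
    (b : Fin d → ℕ) (T : Fin d → Set (List ℕ)) (hT : IsVecHomogeneous b T)
    (bW : ℕ) (W : Set (List ℕ)) (hW : IsHomogeneous bW W)
    (ε : ℝ) (hε0 : 0 < ε) (hε1 : ε ≤ 1)
    (l : ℕ → ℕ) (D : (Fin d → List ℕ) → Set (List ℕ))
    (hD : IsDenseLevelSel T W l ε D) :
    ∀ δ : ℝ, 0 < δ → δ < ε →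
      ∃ (R : Fin d → Set (List ℕ)) (r0 : Fin d → List ℕ) (θ : ℝ),
        IsVecStrongSubtree T R ∧ IsRoot R r0 ∧ 0 < θ ∧ θ ≤ 1 ∧
          ∀ m, r0 ∈ vecLevel T m →
            dens W (l m) (D r0) - δ
              ≤ dens W (l m) {w ∈ D r0 | StronglyCorrelated T W bW l D R r0 w θ} := by
  intro δ hδ _
  have hb : ∀ i, 0 < b i := fun i => by have := (hT i).1; omega
  have hc : 0 < bW := by have := hW.1; omega
  have hc' : (0 : ℝ) < bW := by exact_mod_cast hc
  choose hT' gT hgT hTg using fun i => (hT i).exists_isStrongEmb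
  obtain ⟨hW', gW, hgW, rfl⟩ := hW.exists_isStrongEmb
  have hinj := hgW.node_injective hc
  have hTlev : ∀ n (t : ∀ i, List (Fin (b i))),
      (fun i => node (gT i) (t i)) ∈ vecLevel T n ↔ t ∈ tuples b n := by
    intro n t
    rw [mem_tuples]
    refine forall_congr' fun i => ?_
    rw [hTg]
    exact (hgT i).node_mem_level_iff (hb i)
  let A : (∀ i, List (Fin (b i))) → Set (List (Fin bW)) := fun t =>
    {v | node gW v ∈ D fun i => node (gT i) (t i)}
  have hDA : ∀ n, ∀ t ∈ tuples b n, D (fun i => node (gT i) (t i)) = node gW '' A t := by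
    intro n t ht
    ext x
    refine ⟨fun hx => ?_, ?_⟩
    · obtain ⟨v, rfl⟩ := ((hD.2 n _ ((hTlev n t).2 ht)).1 hx).1
      exact ⟨v, hx, rfl⟩
    · rintro ⟨v, hv, rfl⟩
      exact hv
  have hA : IsLevelMap A l := ⟨hD.1, fun n t ht v hv =>
    (hgW.node_mem_level_iff hc).1 ((hD.2 n _ ((hTlev n t).2 ht)).1 hv)⟩
  obtain ⟨θ, hθ0, hθ1, k, g, hk, hg, hgood⟩ :=
    hA.exists_goodSet hd hDHL (fun i => (hT i).1) hc hδ
  have hgt : ∀ n, ∀ t ∈ tuples b n, (fun i => g i (t i)) ∈ tuples b (k n) := fun n t ht =>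
    mem_tuples.2 fun i => by rw [(hg i).1, mem_tuples.1 ht i]
  have hroot : (fun i => g i []) ∈ tuples b (k 0) := hgt 0 _ (mem_tuples.2 fun _ => rfl)
  have hgTg : ∀ i, IsStrongEmb (hT' i ∘ k) (gT i ∘ g i) := fun i => (hgT i).comp (hg i)
  refine ⟨fun i => Set.range (node (gT i ∘ g i)), fun i => node (gT i ∘ g i) [], θ,
    ⟨k, fun i => ?_⟩, fun i => ?_, hθ0, hθ1, fun m hm => ?_⟩
  · rw [hTg]
    exact (hgT i).isStrongSubtreeWith (hb i) (hg i)
  · rw [(hgTg i).level_eq (hb i)]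
    simp [List.length_eq_zero_iff]
  have hlevel_unique : ∀ {t : ∀ i, List (Fin (b i))} {m m' : ℕ}, t ∈ tuples b m →
      t ∈ tuples b m' → m = m' := fun {t m m'} h1 h2 =>
    (mem_tuples.1 h1 ⟨0, hd⟩).symm.trans (mem_tuples.1 h2 ⟨0, hd⟩)
  obtain rfl := hlevel_unique hroot ((hTlev m fun i => g i []).1 hm)
  have hDr := hDA _ _ hroot
  change D (fun i => node (gT i ∘ g i) []) = _ at hDr
  have hcorr : ∀ w ∈ goodSet (fun t => A fun i => g i (t i)) (l ∘ k) θ 0 fun _ => [],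
      StronglyCorrelated T (Set.range (node gW)) bW l D (fun i => Set.range (node (gT i ∘ g i)))
        (fun i => node (gT i ∘ g i) []) (node gW w) θ := by
    rintro w ⟨hw, hwgood⟩
    refine ⟨hw, fun F hF hFroot n hn p _ s hs => ?_⟩
    obtain ⟨n', σ, hσ, hF1⟩ := hF.exists_fanNode hb hgTg hFroot
    obtain ⟨p', rfl⟩ := (hgW.immSuc_iff hc w s).1 hs.1
    have hnode : ∀ q, (fun i => g i (fanNode (fun _ => []) σ q i)) ∈ tuples b (k (0 + 1 + n')) :=
      fun q => hgt _ _ (fanNode_mem_tuples (r := fun _ => []) (fun _ => List.length_nil) hσ q)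
    obtain rfl : n = k (0 + 1 + n') := by
      let q₀ : ∀ i, Fin (b i) := fun i => ⟨0, hb i⟩
      have h0 : (fun i => node (gT i ∘ g i) (fanNode (fun _ => []) σ q₀ i)) ∈ vecLevel F 1 := by
        rw [hF1]
        exact Set.mem_range_self q₀
      have h1 := hn h0
      exact hlevel_unique ((hTlev n fun i => g i (fanNode (fun _ => []) σ q₀ i)).1 h1) (hnode q₀)
    have hwlen : w.length = l (k 0) := hA.2 _ _ hroot w hw
    have hlk : l (k 0) + 1 ≤ l (k (0 + 1 + n')) := hD.1 (hk (by omega))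
    have hset : (⋂ r ∈ vecLevel F 1, D r) ∩ suc (Set.range (node gW)) (node gW (w ++ [p'])) =
        node gW '' fanSet (fun t => A fun i => g i (t i)) (fun _ => []) σ (w ++ [p']) := by
      rw [hF1, Set.biInter_range]
      ext x
      constructor
      · rintro ⟨hx, ⟨v, rfl⟩, hv⟩
        exact ⟨v, ⟨(hgW.node_prefix_iff hc).1 hv, fun q => Set.mem_iInter.1 hx q⟩, rfl⟩
      · rintro ⟨v, ⟨hv, hvq⟩, rfl⟩
        exact ⟨Set.mem_iInter.2 hvq, ⟨v, rfl⟩, (hgW.node_prefix_iff hc).2 hv⟩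
    rw [densRel, hset, Set.ncard_image_of_injective _ hinj,
      hgW.ncard_level_inter_suc hc (by simpa [hwlen] using hlk)]
    have h1 := hwgood p' n' σ hσ
    simp only [FanGood, Function.comp_apply] at h1
    push_cast
    rw [le_div_iff₀ (by positivity)]
    refine le_of_mul_le_mul_right (h1.trans' (le_of_eq ?_))
      (show (0 : ℝ) < (bW : ℝ) ^ (l (k 0) + 1) by positivity)
    rw [mul_assoc, ← pow_add]
    congr 2
    rw [List.length_append, hwlen]
    exact Nat.sub_add_cancel hlk
  simp only [dens, hgW.ncard_level hc]
  push_cast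
  have hpow : (0 : ℝ) < (bW : ℝ) ^ l (k 0) := by positivity
  rw [div_sub' hpow.ne', div_le_div_iff_of_pos_right hpow, mul_comm _ δ]
  nth_rewrite 1 [hDr]
  rw [Set.ncard_image_of_injective _ hinj]
  refine hgood.trans ?_
  rw [← Set.ncard_image_of_injective _ hinj]
  refine Nat.cast_le.2 (Set.ncard_le_ncard ?_ ?_)
  · rintro _ ⟨w, hw, rfl⟩
    exact ⟨hw.1, hcorr w hw⟩
  · refine Set.Finite.subset (s := D fun i => node (gT i ∘ g i) []) ?_ fun x hx => hx.1
    rw [hDr]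
    exact ((finite_words bW (l (k 0))).subset fun v hv => hA.2 _ _ hroot v hv).image _
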